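/- arXiv:2511.11779 — 8 statements merged into one kernel-verified Lean document; each statement's English description precedes it below -/
import Mathlib

section
/- Let m ∈ (0,1], let f(q) = ∑_{k=0}^∞ qᵏ pₖ belong to SB(𝔹), and for each k ≥ 1 let ωₖ ∈ SB_k(𝔹). Then |p₀|^m + ∑_{k=1}^∞ |ωₖ(q)| |pₖ| + (1/(1+|p₀|) + |ω₁(q)|/(1−|ω₁(q)|)) · ∑_{k=1}^∞ |ωₖ(q)|² |pₖ|² ≤ 1 for every q ∈ 𝔹 with |q| ≤ m/(m+2). -/
noncomputable section
open scoped Quaternion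

/-- Value of the slice regular function with Taylor coefficients `p` at `q`. -/
noncomputable def sliceVal (p : ℕ → ℍ[ℝ]) (q : ℍ[ℝ]) : ℍ[ℝ] := ∑' k : ℕ, q ^ k * p k

/-- The power series with coefficients `p` converges on the open unit ball. -/
def SliceRegOn (p : ℕ → ℍ[ℝ]) : Prop :=
  ∀ q : ℍ[ℝ], ‖q‖ < 1 → Summable fun k : ℕ => q ^ k * p k

/-- The class `SB(𝔹)` of slice regular self-maps of the unit ball. -/
def SBClass (p : ℕ → ℍ[ℝ]) : Prop :=
  SliceRegOn p ∧ ∀ q : ℍ[ℝ], ‖q‖ < 1 → ‖sliceVal p q‖ < 1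

/-- The class `SB_n(𝔹)`: members of `SB(𝔹)` whose Taylor coefficients of order
`0, …, n-1` vanish and whose `n`-th Taylor coefficient is nonzero. -/
def SBnClass (n : ℕ) (p : ℕ → ℍ[ℝ]) : Prop :=
  SBClass p ∧ (∀ j, j < n → p j = 0) ∧ p n ≠ 0


namespace BohrAux

open Quaternion

lemma nsq (a : ℍ[ℝ]) : ‖a‖ ^ 2 = a.re ^ 2 + a.imI ^ 2 + a.imJ ^ 2 + a.imK ^ 2 := by
  rw [sq ‖a‖, ← normSq_eq_norm_mul_self, normSq_def']

lemma unit_sq (K : ℍ[ℝ]) (hre : K.re = 0) (hn : ‖K‖ = 1) : K * K = -1 := by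
  have h := nsq K
  rw [hn, hre] at h
  ext <;> simp [hre] <;> nlinarith

lemma deMoivre (K : ℍ[ℝ]) (hre : K.re = 0) (hn : ‖K‖ = 1) (t : ℝ) (k : ℕ) :
    (((Real.cos t : ℝ) : ℍ[ℝ]) + (Real.sin t : ℝ) * K) ^ k =
      ((Real.cos (k * t) : ℝ) : ℍ[ℝ]) + (Real.sin (k * t) : ℝ) * K := by
  have hK := unit_sq K hre hn
  induction k with
  | zero => simp
  | succ k ih =>
    rw [pow_succ, ih]
    push_cast
    rw [show ((k : ℝ) + 1) * t = k * t + t by ring, Real.cos_add, Real.sin_add]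
    have h := nsq K
    rw [hn, hre] at h
    ext <;> simp [hre] <;> try ring_nf
    linear_combination (Real.sin (k * t) * Real.sin t) * h

/-- Existence of the extremal imaginary unit. -/
lemma exists_unit (x y z : ℝ) : ∃ K : ℍ[ℝ], K.re = 0 ∧ ‖K‖ = 1 ∧
    K.imI * x + K.imJ * y + K.imK * z = Real.sqrt (x ^ 2 + y ^ 2 + z ^ 2) := by
  set s := Real.sqrt (x ^ 2 + y ^ 2 + z ^ 2) with hs
  have hs2 : s ^ 2 = x ^ 2 + y ^ 2 + z ^ 2 := Real.sq_sqrt (by positivity)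
  have h0 : 0 ≤ s := Real.sqrt_nonneg _
  have key : ∀ K : ℍ[ℝ], K.re ^ 2 + K.imI ^ 2 + K.imJ ^ 2 + K.imK ^ 2 = 1 → ‖K‖ = 1 := by
    intro K hK
    have := nsq K
    rw [hK] at this
    have h1 := norm_nonneg K
    nlinarith
  rcases h0.eq_or_lt with h | h
  · refine ⟨⟨0, 1, 0, 0⟩, rfl, key _ (by simp), ?_⟩
    have hx : x = 0 := by nlinarith [sq_nonneg x, sq_nonneg y, sq_nonneg z]
    simp [hx, ← h]
  · refine ⟨⟨0, x / s, y / s, z / s⟩, rfl, key _ ?_, ?_⟩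
    · field_simp
      linarith
    · field_simp
      linarith

lemma stem_id (α β A B : ℍ[ℝ]) : ‖α * A - β * B‖ ^ 2 + ‖α * B + β * A‖ ^ 2 =
      (‖α‖ ^ 2 + ‖β‖ ^ 2) * (‖A‖ ^ 2 + ‖B‖ ^ 2) -
        4 * ((star β * α).imI * (B * star A).imI + (star β * α).imJ * (B * star A).imJ
          + (star β * α).imK * (B * star A).imK) := by
  rw [nsq, nsq, nsq α, nsq β, nsq A, nsq B]
  simp only [re_sub, imI_sub, imJ_sub, imK_sub, re_add, imI_add, imJ_add, imK_add, re_mul, imI_mul,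
    imJ_mul, imK_mul, re_star, imI_star, imJ_star, imK_star]
  ring

lemma im_comm (α β : ℍ[ℝ]) :
    (α * star β).imI ^ 2 + (α * star β).imJ ^ 2 + (α * star β).imK ^ 2 =
    (star β * α).imI ^ 2 + (star β * α).imJ ^ 2 + (star β * α).imK ^ 2 := by
  simp only [re_mul, imI_mul, imJ_mul, imK_mul, re_star, imI_star, imJ_star, imK_star]
  ring

lemma norm_add_K (α β K : ℍ[ℝ]) (hre : K.re = 0) (hn : ‖K‖ = 1) :
    ‖α + K * β‖ ^ 2 = ‖α‖ ^ 2 + ‖β‖ ^ 2 + 2 * (K.imI * (α * star β).imI +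
      K.imJ * (α * star β).imJ + K.imK * (α * star β).imK) := by
  have e : ‖α + K * β‖ ^ 2 = ‖α‖ ^ 2 + ‖K * β‖ ^ 2 + 2 * (K.imI * (α * star β).imI +
      K.imJ * (α * star β).imJ + K.imK * (α * star β).imK) := by
    rw [nsq, nsq α, nsq (K * β)]
    simp only [re_add, imI_add, imJ_add, imK_add, re_mul, imI_mul,
      imJ_mul, imK_mul, re_star, imI_star, imJ_star, imK_star, hre]
    ring
  rw [e, norm_mul, hn, one_mul]

lemma stem_contraction (α β A B : ℍ[ℝ]) (c : ℝ)
    (h : ∀ K : ℍ[ℝ], K.re = 0 → ‖K‖ = 1 → ‖α + K * β‖ ≤ c) :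
    ‖α * A - β * B‖ ^ 2 + ‖α * B + β * A‖ ^ 2 ≤ c ^ 2 * (‖A‖ ^ 2 + ‖B‖ ^ 2) := by
  obtain ⟨K, hre, hn, hK⟩ := exists_unit (α * star β).imI (α * star β).imJ (α * star β).imK
  set u := Real.sqrt ((α * star β).imI ^ 2 + (α * star β).imJ ^ 2 + (α * star β).imK ^ 2) with hu
  have hu2 : u ^ 2 = (α * star β).imI ^ 2 + (α * star β).imJ ^ 2 + (α * star β).imK ^ 2 :=
    Real.sq_sqrt (by positivity)
  have hu0 : 0 ≤ u := Real.sqrt_nonneg _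
  have hc : ‖α‖ ^ 2 + ‖β‖ ^ 2 + 2 * u ≤ c ^ 2 := by
    have h1 := h K hre hn
    have h2 : ‖α + K * β‖ ^ 2 ≤ c ^ 2 := by gcongr
    rw [norm_add_K α β K hre hn, hK] at h2
    linarith
  set v := star β * α with hv
  set w := B * star A with hw
  have hv2 : u ^ 2 = v.imI ^ 2 + v.imJ ^ 2 + v.imK ^ 2 := by
    rw [hu2, im_comm]
  have hw2 : w.imI ^ 2 + w.imJ ^ 2 + w.imK ^ 2 ≤ ((‖A‖ ^ 2 + ‖B‖ ^ 2) / 2) ^ 2 := by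
    have e : ‖w‖ ^ 2 = ‖A‖ ^ 2 * ‖B‖ ^ 2 := by
      rw [hw, norm_mul, Quaternion.norm_star]; ring
    have e2 := nsq w
    nlinarith [sq_nonneg (‖A‖ ^ 2 - ‖B‖ ^ 2), sq_nonneg w.re]
  have hid := stem_id α β A B
  rw [← hv, ← hw] at hid
  set X := ‖A‖ ^ 2 + ‖B‖ ^ 2 with hX
  have hX0 : 0 ≤ X := by positivity
  have hcs : (v.imI * w.imI + v.imJ * w.imJ + v.imK * w.imK) ^ 2 ≤ (u * (X / 2)) ^ 2 := by
    have : (v.imI * w.imI + v.imJ * w.imJ + v.imK * w.imK) ^ 2 ≤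
        (v.imI ^ 2 + v.imJ ^ 2 + v.imK ^ 2) * (w.imI ^ 2 + w.imJ ^ 2 + w.imK ^ 2) := by
      nlinarith [sq_nonneg (v.imI * w.imJ - v.imJ * w.imI),
        sq_nonneg (v.imI * w.imK - v.imK * w.imI), sq_nonneg (v.imJ * w.imK - v.imK * w.imJ)]
    rw [mul_pow, hv2]
    refine this.trans ?_
    gcongr
  have habs := abs_le.1 (abs_le_of_sq_le_sq hcs (by positivity))
  rw [hid]
  nlinarith [habs.1, habs.2, mul_le_mul_of_nonneg_right hc hX0]

end BohrAux

namespace BohrAux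

open Quaternion Finset MeasureTheory

noncomputable def Cc (h : ℕ → ℍ[ℝ]) (M : ℕ) (t : ℝ) : ℍ[ℝ] := ∑ k ∈ range M, Real.cos (k * t) • h k
noncomputable def Ss (h : ℕ → ℍ[ℝ]) (M : ℕ) (t : ℝ) : ℍ[ℝ] := ∑ k ∈ range M, Real.sin (k * t) • h k

lemma continuous_Cc (h : ℕ → ℍ[ℝ]) (M : ℕ) : Continuous (Cc h M) := by
  unfold Cc; fun_prop

lemma continuous_Ss (h : ℕ → ℍ[ℝ]) (M : ℕ) : Continuous (Ss h M) := by
  unfold Ss; fun_prop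

lemma integral_cos_nat (n : ℕ) (hn : n ≠ 0) :
    ∫ t in (0 : ℝ)..(2 * Real.pi), Real.cos (n * t) = 0 := by
  have hn' : (n : ℝ) ≠ 0 := by exact_mod_cast hn
  rw [intervalIntegral.integral_comp_mul_left (fun x => Real.cos x) hn', integral_cos]
  have : Real.sin ((n : ℝ) * (2 * Real.pi)) = 0 := by
    have := Real.sin_nat_mul_pi (n * 2)
    push_cast at this
    rw [← this]; ring_nf
  simp [this]

lemma parseval (h : ℕ → ℍ[ℝ]) (M : ℕ) :
    ∫ t in (0 : ℝ)..(2 * Real.pi), (‖Cc h M t‖ ^ 2 + ‖Ss h M t‖ ^ 2) =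
      2 * Real.pi * ∑ k ∈ range M, ‖h k‖ ^ 2 := by
  induction M with
  | zero => simp [Cc, Ss]
  | succ M ih =>
    have e : ∀ t, ‖Cc h (M + 1) t‖ ^ 2 + ‖Ss h (M + 1) t‖ ^ 2 =
        (‖Cc h M t‖ ^ 2 + ‖Ss h M t‖ ^ 2) + ‖h M‖ ^ 2 +
          ∑ k ∈ range M, 2 * inner ℝ (h k) (h M) * Real.cos ((M - k : ℕ) * t) := by
      intro t
      have e1 : Cc h (M + 1) t = Cc h M t + Real.cos (M * t) • h M := by
        simp [Cc, sum_range_succ]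
      have e2 : Ss h (M + 1) t = Ss h M t + Real.sin (M * t) • h M := by
        simp [Ss, sum_range_succ]
      have e3 : ∑ k ∈ range M, 2 * inner ℝ (h k) (h M) * Real.cos ((M - k : ℕ) * t) =
          2 * (Real.cos (M * t) * inner ℝ (Cc h M t) (h M) +
            Real.sin (M * t) * inner ℝ (Ss h M t) (h M)) := by
        rw [Cc, Ss, sum_inner, sum_inner, mul_sum, mul_sum, ← sum_add_distrib, mul_sum]
        refine sum_congr rfl fun k hk => ?_
        rw [Nat.cast_sub (mem_range.1 hk).le, sub_mul, Real.cos_sub, real_inner_smul_left,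
          real_inner_smul_left]
        ring
      rw [e1, e2, e3, norm_add_sq_real, norm_add_sq_real, real_inner_smul_right,
        real_inner_smul_right, norm_smul, norm_smul, mul_pow, mul_pow, Real.norm_eq_abs,
        Real.norm_eq_abs, sq_abs, sq_abs]
      linear_combination ‖h M‖ ^ 2 * Real.cos_sq_add_sin_sq (M * t)
    have c1 := continuous_Cc h M
    have c2 := continuous_Ss h M
    simp_rw [e]
    rw [intervalIntegral.integral_add, intervalIntegral.integral_add, ih,
      intervalIntegral.integral_finsetSum]
    · rw [sum_range_succ, Finset.sum_eq_zero (s := range M) (f := fun k => ∫ _ in _.._, _)]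
      · simp; ring
      · intro k hk
        rw [intervalIntegral.integral_const_mul, integral_cos_nat, mul_zero]
        have := mem_range.1 hk
        omega
    all_goals try intro k hk
    all_goals refine Continuous.intervalIntegrable ?_ _ _
    all_goals fun_prop

noncomputable def conv (P g : ℕ → ℍ[ℝ]) (M L n : ℕ) : ℍ[ℝ] :=
  ∑ x ∈ range M ×ˢ range L with x.1 + x.2 = n, P x.1 * g x.2

lemma sum_conv (P g : ℕ → ℍ[ℝ]) (M L : ℕ) (φ : ℕ → ℝ) :
    ∑ n ∈ range (M + L), φ n • conv P g M L n =
      ∑ i ∈ range M, ∑ j ∈ range L, φ (i + j) • (P i * g j) := by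
  rw [← sum_product', ← sum_fiberwise_of_maps_to (t := range (M + L)) (g := fun x : ℕ × ℕ => x.1 + x.2)]
  · refine sum_congr rfl fun n _ => ?_
    rw [conv, smul_sum]
    refine sum_congr rfl fun x hx => ?_
    rw [(mem_filter.1 hx).2]
  · intro x hx
    simp only [mem_product, mem_range] at hx ⊢
    omega

lemma Cc_conv (P g : ℕ → ℍ[ℝ]) (M L : ℕ) (t : ℝ) :
    Cc (conv P g M L) (M + L) t = Cc P M t * Cc g L t - Ss P M t * Ss g L t := by
  rw [Cc, sum_conv P g M L (fun n => Real.cos (n * t)), Cc, Cc, Ss, Ss, sum_mul_sum, sum_mul_sum,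
    ← sum_sub_distrib]
  refine sum_congr rfl fun i _ => ?_
  rw [← sum_sub_distrib]
  refine sum_congr rfl fun j _ => ?_
  push_cast
  rw [add_mul, Real.cos_add, smul_mul_smul_comm, smul_mul_smul_comm, sub_smul]

lemma Ss_conv (P g : ℕ → ℍ[ℝ]) (M L : ℕ) (t : ℝ) :
    Ss (conv P g M L) (M + L) t = Cc P M t * Ss g L t + Ss P M t * Cc g L t := by
  rw [Ss, sum_conv P g M L (fun n => Real.sin (n * t)), Cc, Cc, Ss, Ss, sum_mul_sum, sum_mul_sum,
    ← sum_add_distrib]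
  refine sum_congr rfl fun i _ => ?_
  rw [← sum_add_distrib]
  refine sum_congr rfl fun j _ => ?_
  push_cast
  rw [add_mul, Real.sin_add, smul_mul_smul_comm, smul_mul_smul_comm, add_smul, add_comm]

lemma toeplitz_poly (P g : ℕ → ℍ[ℝ]) (M L : ℕ) (c : ℝ)
    (h : ∀ t : ℝ, ∀ K : ℍ[ℝ], K.re = 0 → ‖K‖ = 1 → ‖Cc P M t + K * Ss P M t‖ ≤ c) :
    ∑ n ∈ range (M + L), ‖conv P g M L n‖ ^ 2 ≤ c ^ 2 * ∑ j ∈ range L, ‖g j‖ ^ 2 := by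
  have h1 := parseval (conv P g M L) (M + L)
  have h2 := parseval g L
  have c1 := continuous_Cc g L
  have c2 := continuous_Ss g L
  have c3 := continuous_Cc (conv P g M L) (M + L)
  have c4 := continuous_Ss (conv P g M L) (M + L)
  have h3 : ∫ t in (0 : ℝ)..(2 * Real.pi), (‖Cc (conv P g M L) (M + L) t‖ ^ 2 +
      ‖Ss (conv P g M L) (M + L) t‖ ^ 2) ≤
      ∫ t in (0 : ℝ)..(2 * Real.pi), c ^ 2 * (‖Cc g L t‖ ^ 2 + ‖Ss g L t‖ ^ 2) := by
    refine intervalIntegral.integral_mono (by positivity) ?_ ?_ ?_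
    · exact Continuous.intervalIntegrable (by fun_prop) _ _
    · exact Continuous.intervalIntegrable (by fun_prop) _ _
    · intro t
      simp only [Cc_conv, Ss_conv]
      exact stem_contraction _ _ _ _ c (h t)
  rw [intervalIntegral.integral_const_mul, h1, h2] at h3
  have hpi := Real.pi_pos
  have : 2 * Real.pi * ∑ n ∈ range (M + L), ‖conv P g M L n‖ ^ 2 ≤
      2 * Real.pi * (c ^ 2 * ∑ j ∈ range L, ‖g j‖ ^ 2) := by linarith
  exact le_of_mul_le_mul_left this (by positivity)

lemma conv_eq (P g : ℕ → ℍ[ℝ]) (M L n : ℕ) (hM : n < M) (hL : n < L) :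
    conv P g M L n = ∑ i ∈ range (n + 1), P (n - i) * g i := by
  rw [conv]
  refine sum_nbij' (fun x => x.2) (fun i => (n - i, i)) ?_ ?_ ?_ ?_ ?_
  · intro x hx
    simp only [mem_filter, mem_product, mem_range] at hx ⊢
    omega
  · intro i hi
    simp only [mem_filter, mem_product, mem_range] at hi ⊢
    omega
  · rintro ⟨a, b⟩ hx
    simp only [mem_filter, mem_product, mem_range, Prod.mk.injEq, and_true] at hx ⊢
    omega
  · intro i hi
    rfl
  · rintro ⟨a, b⟩ hx
    simp only [mem_filter, mem_product, mem_range] at hx ⊢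
    rw [show n - b = a by omega]

end BohrAux

namespace BohrAux

open Quaternion Finset Filter Topology

lemma summable_norm_coeff (p : ℕ → ℍ[ℝ]) (hp : SliceRegOn p) (r : ℝ) (h0 : 0 ≤ r) (h1 : r < 1) :
    Summable fun k => r ^ k * ‖p k‖ := by
  have h := hp (r : ℍ[ℝ]) (by rw [norm_coe, Real.norm_eq_abs, abs_of_nonneg h0]; exact h1)
  have h2 := summable_norm_iff.2 h
  refine h2.congr fun k => ?_
  rw [norm_mul, norm_pow, norm_coe, Real.norm_eq_abs, abs_of_nonneg h0]

lemma toeplitz_aux (p : ℕ → ℍ[ℝ]) (hp : SBClass p) (g : ℕ → ℍ[ℝ]) (N : ℕ)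
    (r : ℝ) (h0 : 0 ≤ r) (h1 : r < 1) (ε : ℝ) (hε : 0 < ε) :
    ∑ n ∈ range N, ‖∑ i ∈ range (n + 1), (r ^ (n - i) • p (n - i)) * g i‖ ^ 2 ≤
      (1 + ε) ^ 2 * ∑ j ∈ range N, ‖g j‖ ^ 2 := by
  have hs := summable_norm_coeff p hp.1 r h0 h1
  have ht := tendsto_sum_nat_add (fun k => r ^ k * ‖p k‖)
  obtain ⟨M, hM, hMN⟩ := ((ht.eventually (gt_mem_nhds hε)).and (eventually_ge_atTop N)).exists
  set P : ℕ → ℍ[ℝ] := fun k => r ^ k • p k with hP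
  have key := toeplitz_poly P g M N (1 + ε) ?_
  · refine le_trans ?_ key
    refine le_trans (le_of_eq ?_) (sum_le_sum_of_subset_of_nonneg
      (range_subset_range.2 (Nat.le_add_left N M)) fun _ _ _ => by positivity)
    refine sum_congr rfl fun n hn => ?_
    have := mem_range.1 hn
    rw [conv_eq P g M N n (by omega) this]
  · intro t K hre hn
    set q : ℍ[ℝ] := r • (((Real.cos t : ℝ) : ℍ[ℝ]) + (Real.sin t : ℝ) * K) with hq
    have hu : ‖((Real.cos t : ℝ) : ℍ[ℝ]) + (Real.sin t : ℝ) * K‖ = 1 := by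
      have h := nsq (((Real.cos t : ℝ) : ℍ[ℝ]) + (Real.sin t : ℝ) * K)
      have h2 := nsq K
      rw [hn] at h2
      simp [hre] at h h2
      have h3 := Real.cos_sq_add_sin_sq t
      have h4 := norm_nonneg (((Real.cos t : ℝ) : ℍ[ℝ]) + (Real.sin t : ℝ) * K)
      have h5 : ‖((Real.cos t : ℝ) : ℍ[ℝ]) + (Real.sin t : ℝ) * K‖ ^ 2 = 1 := by
        rw [h]
        linear_combination (-(Real.sin t)^2) * h2 + h3
      nlinarith
    have hqn : ‖q‖ = r := by
      rw [hq, norm_smul, hu, Real.norm_eq_abs, abs_of_nonneg h0, mul_one]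
    have hterm : ∀ k, q ^ k * p k =
        Real.cos (k * t) • P k + K * (Real.sin (k * t) • P k) := by
      intro k
      rw [hq, smul_pow, deMoivre K hre hn, hP]
      simp only [add_mul, smul_add, mul_smul_comm, smul_mul_assoc, mul_assoc, coe_mul_eq_smul]
      congr 1
      · rw [smul_comm]
      · rw [smul_comm]
    have hsum : Cc P M t + K * Ss P M t = ∑ k ∈ range M, q ^ k * p k := by
      rw [Cc, Ss, mul_sum, ← sum_add_distrib]
      exact sum_congr rfl fun k _ => (hterm k).symm
    have hreg := hp.1 q (by rw [hqn]; exact h1)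
    have hval := hp.2 q (by rw [hqn]; exact h1)
    have hsplit := hreg.sum_add_tsum_nat_add M
    have hnorm : ∀ k, ‖q ^ k * p k‖ = r ^ k * ‖p k‖ := fun k => by
      rw [norm_mul, norm_pow, hqn]
    have htail : ‖∑' k, q ^ (k + M) * p (k + M)‖ ≤ ε := by
      refine le_trans (norm_tsum_le_tsum_norm ?_) ?_
      · simp only [hnorm]
        exact (summable_nat_add_iff M).2 hs
      · simp only [hnorm]
        exact hM.le
    rw [hsum, eq_sub_of_add_eq hsplit]
    refine (norm_sub_le _ _).trans ?_
    exact add_le_add hval.le htail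

lemma toeplitz (p : ℕ → ℍ[ℝ]) (hp : SBClass p) (g : ℕ → ℍ[ℝ]) (N : ℕ) :
    ∑ n ∈ range N, ‖∑ i ∈ range (n + 1), p (n - i) * g i‖ ^ 2 ≤
      ∑ j ∈ range N, ‖g j‖ ^ 2 := by
  have h1 : ∀ r : ℝ, 0 ≤ r → r < 1 →
      ∑ n ∈ range N, ‖∑ i ∈ range (n + 1), (r ^ (n - i) • p (n - i)) * g i‖ ^ 2 ≤
        ∑ j ∈ range N, ‖g j‖ ^ 2 := by
    intro r h0 h1
    have hc : Tendsto (fun ε : ℝ => (1 + ε) ^ 2 * ∑ j ∈ range N, ‖g j‖ ^ 2) (𝓝[>] 0)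
        (𝓝 ((1 + 0) ^ 2 * ∑ j ∈ range N, ‖g j‖ ^ 2)) := by
      apply Tendsto.mono_left _ nhdsWithin_le_nhds
      apply Continuous.tendsto
      fun_prop
    have := ge_of_tendsto hc (eventually_mem_nhdsWithin.mono
      fun ε hε => toeplitz_aux p hp g N r h0 h1 ε hε)
    simpa using this
  have hc : Tendsto (fun r : ℝ => ∑ n ∈ range N,
      ‖∑ i ∈ range (n + 1), (r ^ (n - i) • p (n - i)) * g i‖ ^ 2) (𝓝[<] 1)
      (𝓝 (∑ n ∈ range N, ‖∑ i ∈ range (n + 1), ((1 : ℝ) ^ (n - i) • p (n - i)) * g i‖ ^ 2)) := by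
    apply Tendsto.mono_left _ nhdsWithin_le_nhds
    apply Continuous.tendsto (f := fun r : ℝ => ∑ n ∈ range N,
      ‖∑ i ∈ range (n + 1), (r ^ (n - i) • p (n - i)) * g i‖ ^ 2)
    fun_prop
  have := le_of_tendsto hc (b := ∑ j ∈ range N, ‖g j‖ ^ 2) (by
    filter_upwards [Ioo_mem_nhdsLT (show (0 : ℝ) < 1 by norm_num)] with r hr
    exact h1 r hr.1.le hr.2)
  simpa using this

lemma exists_phase (x : ℍ[ℝ]) : ∃ l : ℍ[ℝ], ‖l‖ = 1 ∧ x = ‖x‖ • l := by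
  by_cases h : x = 0
  · exact ⟨1, by simp, by simp [h]⟩
  · have : ‖x‖ ≠ 0 := norm_ne_zero_iff.2 h
    refine ⟨‖x‖⁻¹ • x, ?_, ?_⟩
    · rw [norm_smul, norm_inv, norm_norm, inv_mul_cancel₀ this]
    · rw [smul_smul, mul_inv_cancel₀ this, one_smul]

lemma carlson_odd (p : ℕ → ℍ[ℝ]) (hp : SBClass p) (n : ℕ) :
    ‖p (2 * n + 1)‖ ≤ 1 - ∑ k ∈ range (n + 1), ‖p k‖ ^ 2 := by
  obtain ⟨l, hl, hpl⟩ := exists_phase (p (2 * n + 1))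
  set b := ‖p (2 * n + 1)‖
  have hb : 0 ≤ b := norm_nonneg _
  set s := ∑ k ∈ range (n + 1), ‖p k‖ ^ 2 with hs
  have hs0 : 0 ≤ s := by positivity
  set g : ℕ → ℍ[ℝ] := fun j => if j = 0 then 1 else
    if n + 1 ≤ j then star (p (2 * n + 1 - j)) * l else 0 with hg
  have g0 : g 0 = 1 := by simp [hg]
  have gm : ∀ j, j < n → g (j + 1) = 0 := by
    intro j hj
    have : ¬ (n + 1 ≤ j + 1) := by omega
    have h3 : j + 1 ≠ 0 := by omega
    simp only [hg, this, h3, if_false]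
  have gl : ∀ i, g (n + 1 + i) = star (p (n - i)) * l := by
    intro i
    have e : 2 * n + 1 - (n + 1 + i) = n - i := by omega
    have e2 : n + 1 ≤ n + 1 + i := by omega
    have e3 : n + 1 + i ≠ 0 := by omega
    simp only [hg, e, e2, e3, if_true, if_false]
  clear_value b s g
  have key := toeplitz p hp g (n + 1 + (n + 1))
  have hrefl : ∑ i ∈ range (n + 1), ‖p (n - i)‖ ^ 2 = s := by
    have := sum_range_reflect (fun k => ‖p k‖ ^ 2) (n + 1)
    rw [hs, ← this]
    refine sum_congr rfl fun i _ => ?_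
    rw [Nat.add_sub_cancel]
  have hR : ∑ j ∈ range (n + 1 + (n + 1)), ‖g j‖ ^ 2 = 1 + s := by
    rw [sum_range_add, sum_range_succ']
    rw [sum_eq_zero (s := range n) (fun j hj => by rw [gm j (mem_range.1 hj)]; simp), g0]
    simp only [gl, norm_mul, Quaternion.norm_star, hl, mul_one, hrefl]
    simp
  have hrow : ∀ k, k ≤ n → ∑ i ∈ range (k + 1), p (k - i) * g i = p k := by
    intro k hk
    rw [sum_range_succ', sum_eq_zero (fun j hj => by
      rw [gm j (by have := mem_range.1 hj; omega), mul_zero]), g0]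
    simp
  have hlast : ∑ i ∈ range (n + 1 + n + 1), p (n + 1 + n - i) * g i = (b + s) • l := by
    rw [show n + 1 + n + 1 = n + 1 + (n + 1) by ring, sum_range_add, sum_range_succ',
      sum_eq_zero (s := range n) (fun j hj => by rw [gm j (mem_range.1 hj), mul_zero]), g0]
    simp only [gl]
    have : ∀ i ∈ range (n + 1), p (n + 1 + n - (n + 1 + i)) * (star (p (n - i)) * l) =
        ‖p (n - i)‖ ^ 2 • l := by
      intro i _
      rw [show n + 1 + n - (n + 1 + i) = n - i by omega, ← mul_assoc, self_mul_star,
        normSq_eq_norm_mul_self, coe_mul_eq_smul, sq]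
    rw [sum_congr rfl this, ← sum_smul, hrefl, add_smul, ← hpl]
    simp
    congr 1; omega
  have hL : s + (b + s) ^ 2 ≤ ∑ k ∈ range (n + 1 + (n + 1)),
      ‖∑ i ∈ range (k + 1), p (k - i) * g i‖ ^ 2 := by
    rw [sum_range_add, sum_range_succ (n := n) (f := fun x =>
      ‖∑ i ∈ range (n + 1 + x + 1), p (n + 1 + x - i) * g i‖ ^ 2), hlast]
    rw [sum_congr rfl (fun k hk => by rw [hrow k (by have := mem_range.1 hk; omega)])]
    have : ‖(b + s) • l‖ ^ 2 = (b + s) ^ 2 := by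
      rw [norm_smul, hl, mul_one, Real.norm_eq_abs, sq_abs]
    rw [this, ← hs]
    have : 0 ≤ ∑ x ∈ range n, ‖∑ i ∈ range (n + 1 + x + 1), p (n + 1 + x - i) * g i‖ ^ 2 :=
      Finset.sum_nonneg fun _ _ => sq_nonneg _
    linarith
  nlinarith

lemma carlson_even (p : ℕ → ℍ[ℝ]) (hp : SBClass p) (n : ℕ) :
    ‖p (2 * n + 2)‖ ≤ 1 - ∑ k ∈ range (n + 1), ‖p k‖ ^ 2 - ‖p (n + 1)‖ ^ 2 / (1 + ‖p 0‖) := by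
  obtain ⟨l, hl, hpl⟩ := exists_phase (p (2 * n + 2))
  set b := ‖p (2 * n + 2)‖
  have hb : 0 ≤ b := norm_nonneg _
  set s := ∑ k ∈ range (n + 1), ‖p k‖ ^ 2 with hs
  set a := ‖p 0‖ with ha
  set d := ‖p (n + 1)‖ with hd
  have hs0 : 0 ≤ s := by positivity
  have ha0 : 0 ≤ a := norm_nonneg _
  have hd0 : 0 ≤ d := norm_nonneg _
  set μ : ℍ[ℝ] := (1 / (1 + a)) • (star (p (n + 1)) * l) with hμ
  have hμn : ‖μ‖ = d / (1 + a) := by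
    rw [hμ, norm_smul, norm_mul, Quaternion.norm_star, hl, Real.norm_eq_abs,
      abs_of_nonneg (by positivity)]
    ring
  set g : ℕ → ℍ[ℝ] := fun j => if j = 0 then 1 else if j = n + 1 then μ else
    if n + 2 ≤ j then star (p (2 * n + 2 - j)) * l else 0 with hg
  have g0 : g 0 = 1 := by simp [hg]
  have gμ : g (n + 1) = μ := by simp [hg]
  have gm : ∀ j, j < n → g (j + 1) = 0 := by
    intro j hj
    have : ¬ (n + 2 ≤ j + 1) := by omega
    have h2 : j + 1 ≠ n + 1 := by omega
    have h3 : j + 1 ≠ 0 := by omega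
    simp only [hg, this, h2, h3, if_false]
  have gl : ∀ i, g (n + 2 + i) = star (p (n - i)) * l := by
    intro i
    have e : 2 * n + 2 - (n + 2 + i) = n - i := by omega
    have e2 : n + 2 ≤ n + 2 + i := by omega
    have e3 : n + 2 + i ≠ 0 := by omega
    have e4 : n + 2 + i ≠ n + 1 := by omega
    simp only [hg, e, e2, e3, e4, if_true, if_false]
  clear_value b s g
  have key := toeplitz p hp g (n + 2 + (n + 1))
  have hrefl : ∑ i ∈ range (n + 1), ‖p (n - i)‖ ^ 2 = s := by
    have := sum_range_reflect (fun k => ‖p k‖ ^ 2) (n + 1)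
    rw [hs, ← this]
    refine sum_congr rfl fun i _ => ?_
    rw [Nat.add_sub_cancel]
  have hR : ∑ j ∈ range (n + 2 + (n + 1)), ‖g j‖ ^ 2 = 1 + ‖μ‖ ^ 2 + s := by
    rw [sum_range_add, sum_range_succ, sum_range_succ']
    rw [sum_eq_zero (s := range n) (fun j hj => by rw [gm j (mem_range.1 hj)]; simp), g0, gμ]
    simp only [gl, norm_mul, Quaternion.norm_star, hl, mul_one, hrefl]
    simp
  have hrow : ∀ k, k ≤ n → ∑ i ∈ range (k + 1), p (k - i) * g i = p k := by
    intro k hk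
    rw [sum_range_succ', sum_eq_zero (fun j hj => by
      rw [gm j (by have := mem_range.1 hj; omega), mul_zero]), g0]
    simp
  have hmid : ∑ i ∈ range (n + 1 + 1), p (n + 1 - i) * g i = p (n + 1) + p 0 * μ := by
    rw [sum_range_succ, sum_range_succ',
      sum_eq_zero (s := range n) (fun j hj => by rw [gm j (mem_range.1 hj), mul_zero]), g0, gμ]
    simp
  have hlast : ∑ i ∈ range (n + 2 + n + 1), p (n + 2 + n - i) * g i =
      (b + d ^ 2 / (1 + a) + s) • l := by
    rw [show n + 2 + n + 1 = n + 2 + (n + 1) by ring, sum_range_add, sum_range_succ,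
      sum_range_succ',
      sum_eq_zero (s := range n) (fun j hj => by rw [gm j (mem_range.1 hj), mul_zero]), g0, gμ]
    simp only [gl]
    have : ∀ i ∈ range (n + 1), p (n + 2 + n - (n + 2 + i)) * (star (p (n - i)) * l) =
        ‖p (n - i)‖ ^ 2 • l := by
      intro i _
      rw [show n + 2 + n - (n + 2 + i) = n - i by omega, ← mul_assoc, self_mul_star,
        normSq_eq_norm_mul_self, coe_mul_eq_smul, sq]
    have h2 : p (n + 1) * μ = (d ^ 2 / (1 + a)) • l := by
      rw [hμ, mul_smul_comm, ← mul_assoc, self_mul_star, normSq_eq_norm_mul_self,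
        coe_mul_eq_smul, smul_smul, ← hd]
      congr 1; ring
    rw [sum_congr rfl this, ← sum_smul, hrefl, add_smul, add_smul, ← hpl,
      show n + 2 + n - (n + 1) = n + 1 by omega, h2,
      show n + 2 + n - 0 = 2 * n + 2 by omega]
    simp
  have hL : s + ‖p (n + 1) + p 0 * μ‖ ^ 2 + (b + d ^ 2 / (1 + a) + s) ^ 2 ≤
      ∑ k ∈ range (n + 2 + (n + 1)), ‖∑ i ∈ range (k + 1), p (k - i) * g i‖ ^ 2 := by
    rw [sum_range_add, sum_range_succ (n := n) (f := fun x =>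
      ‖∑ i ∈ range (n + 2 + x + 1), p (n + 2 + x - i) * g i‖ ^ 2), hlast,
      sum_range_succ (n := n + 1), hmid]
    rw [sum_congr rfl (fun k hk => by rw [hrow k (by have := mem_range.1 hk; omega)])]
    have : ‖(b + d ^ 2 / (1 + a) + s) • l‖ ^ 2 = (b + d ^ 2 / (1 + a) + s) ^ 2 := by
      rw [norm_smul, hl, mul_one, Real.norm_eq_abs, sq_abs]
    rw [this, ← hs]
    have : 0 ≤ ∑ x ∈ range n, ‖∑ i ∈ range (n + 2 + x + 1), p (n + 2 + x - i) * g i‖ ^ 2 :=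
      Finset.sum_nonneg fun _ _ => sq_nonneg _
    linarith
  have hlow : ‖μ‖ ≤ ‖p (n + 1) + p 0 * μ‖ := by
    have h1 : ‖p (n + 1)‖ - ‖p 0 * μ‖ ≤ ‖p (n + 1) + p 0 * μ‖ := by
      have := norm_sub_le (p (n + 1) + p 0 * μ) (p 0 * μ)
      rw [add_sub_cancel_right] at this
      linarith
    rw [norm_mul, ← hd, ← ha] at h1
    have : d - a * ‖μ‖ = ‖μ‖ := by
      rw [hμn]; field_simp; ring
    linarith
  have hlow2 : ‖μ‖ ^ 2 ≤ ‖p (n + 1) + p 0 * μ‖ ^ 2 := by gcongr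
  have hd1 : 0 ≤ d ^ 2 / (1 + a) := by positivity
  nlinarith

end BohrAux

namespace BohrAux

open Quaternion Finset Filter Topology

lemma exists_slice (q : ℍ[ℝ]) : ∃ K : ℍ[ℝ], ∃ y : ℝ, K.re = 0 ∧ ‖K‖ = 1 ∧
    q = (q.re : ℍ[ℝ]) + (y : ℍ[ℝ]) * K := by
  set s := Real.sqrt (q.imI ^ 2 + q.imJ ^ 2 + q.imK ^ 2) with hs
  have hs2 : s ^ 2 = q.imI ^ 2 + q.imJ ^ 2 + q.imK ^ 2 := Real.sq_sqrt (by positivity)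
  have h0 : 0 ≤ s := Real.sqrt_nonneg _
  have key : ∀ K : ℍ[ℝ], K.re ^ 2 + K.imI ^ 2 + K.imJ ^ 2 + K.imK ^ 2 = 1 → ‖K‖ = 1 := by
    intro K hK
    have := nsq K
    rw [hK] at this
    have h1 := norm_nonneg K
    nlinarith
  have main : ∀ (K : ℍ[ℝ]) (y : ℝ), K.re = 0 → q.imI = y * K.imI → q.imJ = y * K.imJ →
      q.imK = y * K.imK → q = (q.re : ℍ[ℝ]) + (y : ℍ[ℝ]) * K := by
    intro K y h1 h2 h3 h4
    ext <;> simp [h1, h2, h3, h4]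
  rcases h0.eq_or_lt with h | h
  · refine ⟨⟨0, 1, 0, 0⟩, 0, rfl, key _ (by simp), ?_⟩
    have hx : q.imI = 0 := by nlinarith [sq_nonneg q.imI, sq_nonneg q.imJ, sq_nonneg q.imK]
    have hy : q.imJ = 0 := by nlinarith [sq_nonneg q.imI, sq_nonneg q.imJ, sq_nonneg q.imK]
    have hz : q.imK = 0 := by nlinarith [sq_nonneg q.imI, sq_nonneg q.imJ, sq_nonneg q.imK]
    exact main _ _ rfl (by simp [hx]) (by simp [hy]) (by simp [hz])
  · refine ⟨⟨0, q.imI / s, q.imJ / s, q.imK / s⟩, s, rfl, key _ ?_, ?_⟩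
    · field_simp
      linarith
    · refine main _ _ rfl ?_ ?_ ?_
      · change q.imI = s * (q.imI / s)
        field_simp
      · change q.imJ = s * (q.imJ / s)
        field_simp
      · change q.imK = s * (q.imK / s)
        field_simp

noncomputable def Qe (K : ℍ[ℝ]) (z : ℂ) : ℍ[ℝ] := (z.re : ℍ[ℝ]) + (z.im : ℍ[ℝ]) * K

lemma Qe_norm (K : ℍ[ℝ]) (hre : K.re = 0) (hn : ‖K‖ = 1) (z : ℂ) : ‖Qe K z‖ = ‖z‖ := by
  have h := nsq (Qe K z)
  have h2 := nsq K
  rw [hn] at h2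
  simp [hre, Qe] at h h2
  have h3 : ‖Qe K z‖ ^ 2 = ‖z‖ ^ 2 := by
    rw [Complex.sq_norm, Complex.normSq_apply]
    unfold Qe
    rw [h]
    linear_combination (-(z.im)^2) * h2
  exact (sq_eq_sq₀ (norm_nonneg _) (norm_nonneg _)).1 h3

/-- The left `ℂ_K`-linear functional. -/
noncomputable def psi (K u : ℍ[ℝ]) : ℍ[ℝ] →ₗ[ℝ] ℂ where
  toFun x := ⟨(x * star u).re, (-(K * (x * star u))).re⟩
  map_add' x y := by
    apply Complex.ext <;> simp [add_mul, mul_add] <;> ring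
  map_smul' c x := by
    apply Complex.ext <;> simp <;> ring

lemma psi_Qe (K u : ℍ[ℝ]) (hre : K.re = 0) (hn : ‖K‖ = 1) (z : ℂ) (x : ℍ[ℝ]) :
    psi K u (Qe K z * x) = z * psi K u x := by
  have hK := unit_sq K hre hn
  have e : Qe K z * x * star u = z.re • (x * star u) + z.im • (K * (x * star u)) := by
    rw [Qe, coe_mul_eq_smul]
    simp only [add_mul, coe_mul_eq_smul, smul_mul_assoc, mul_assoc]
  have e2 : K * (Qe K z * x * star u) = z.re • (K * (x * star u)) - z.im • (x * star u) := by
    rw [e, mul_add, mul_smul_comm, mul_smul_comm, ← mul_assoc K K, hK, neg_one_mul, smul_neg,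
      sub_eq_add_neg]
  apply Complex.ext
  · change (Qe K z * x * star u).re = (z * ⟨(x * star u).re, (-(K * (x * star u))).re⟩ : ℂ).re
    rw [e, Complex.mul_re, re_add, re_smul, re_smul, re_neg]
    simp only [smul_eq_mul]; ring
  · change (-(K * (Qe K z * x * star u))).re =
      (z * ⟨(x * star u).re, (-(K * (x * star u))).re⟩ : ℂ).im
    rw [e2, Complex.mul_im, re_neg, re_sub, re_smul, re_smul, re_neg]
    simp only [smul_eq_mul]; ring

lemma psi_norm (K u : ℍ[ℝ]) (hre : K.re = 0) (hn : ‖K‖ = 1) (x : ℍ[ℝ]) :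
    ‖psi K u x‖ ≤ ‖x‖ * ‖u‖ := by
  have h1 : ‖x‖ * ‖u‖ = ‖x * star u‖ := by rw [norm_mul, Quaternion.norm_star]
  rw [h1]
  set y := x * star u with hy
  have h2 := nsq y
  have h3 := nsq K
  rw [hn, hre] at h3
  have h4 : ‖psi K u x‖ ^ 2 = y.re ^ 2 + (-(K * y)).re ^ 2 := by
    rw [Complex.sq_norm, Complex.normSq_apply]
    change y.re * y.re + (-(K * y)).re * (-(K * y)).re = _
    ring
  have h5 : (-(K * y)).re = K.imI * y.imI + K.imJ * y.imJ + K.imK * y.imK := by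
    rw [re_neg, re_mul, hre]; ring
  refine (sq_le_sq₀ (norm_nonneg _) (norm_nonneg _)).1 ?_
  rw [h4, h5, h2]
  have h6 : (K.imI * y.imI + K.imJ * y.imJ + K.imK * y.imK) ^ 2 ≤
      (K.imI ^ 2 + K.imJ ^ 2 + K.imK ^ 2) * (y.imI ^ 2 + y.imJ ^ 2 + y.imK ^ 2) := by
    nlinarith [sq_nonneg (K.imI * y.imJ - K.imJ * y.imI),
      sq_nonneg (K.imI * y.imK - K.imK * y.imI), sq_nonneg (K.imJ * y.imK - K.imK * y.imJ)]
  rw [show K.imI ^ 2 + K.imJ ^ 2 + K.imK ^ 2 = 1 by linarith] at h6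
  linarith

lemma psi_self (K u : ℍ[ℝ]) (hre : K.re = 0) : ‖psi K u u‖ = ‖u‖ ^ 2 := by
  have : psi K u u = ((‖u‖ ^ 2 : ℝ) : ℂ) := by
    have e : u * star u = ((‖u‖ ^ 2 : ℝ) : ℍ[ℝ]) := by
      rw [self_mul_star, normSq_eq_norm_mul_self, sq]
    generalize ‖u‖ ^ 2 = t at e ⊢
    apply Complex.ext
    · change (u * star u).re = _
      rw [e]; simp
    · change (-(K * (u * star u))).re = _
      rw [e, re_neg, re_mul, hre]; simp
  rw [this, Complex.norm_real, Real.norm_eq_abs, abs_of_nonneg (by positivity)]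

lemma complex_schwarz (c : ℕ → ℂ) (n : ℕ) (R : ℝ)
    (hs : ∀ r : ℝ, 0 ≤ r → r < 1 → Summable fun k => r ^ k * ‖c k‖)
    (hz : ∀ j, j < n + 1 → c j = 0)
    (hb : ∀ z : ℂ, ‖z‖ < 1 → ‖∑' k, z ^ k * c k‖ ≤ R) (z : ℂ) (hz1 : ‖z‖ < 1) :
    ‖∑' k, z ^ k * c k‖ ≤ R * ‖z‖ ^ (n + 1) := by
  set F : ℂ → ℂ := fun z => ∑' k, z ^ k * c k with hF
  have hF0 : F 0 = 0 := by
    rw [hF]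
    simp only
    rw [tsum_eq_single 0]
    · simp [hz 0 (by omega)]
    · intro k hk; simp [hk]
  have hd : DifferentiableOn ℂ F (Metric.ball 0 1) := by
    intro x hx
    have hx1 : ‖x‖ < 1 := by simpa using hx
    obtain ⟨r, hr1, hr2⟩ := exists_between hx1
    have hr0 : 0 ≤ r := (norm_nonneg x).trans hr1.le
    have : DifferentiableOn ℂ F (Metric.ball 0 r) := by
      refine Complex.differentiableOn_tsum_of_summable_norm (hs r hr0 hr2) ?_ Metric.isOpen_ball ?_
      · intro i; fun_prop
      · intro i w hw
        have hw1 : ‖w‖ < r := by simpa using hw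
        rw [norm_mul, norm_pow]
        gcongr
    exact (this.differentiableAt (Metric.isOpen_ball.mem_nhds (by simpa using hr1))).differentiableWithinAt
  have hO : F =O[𝓝 0] (fun w : ℂ => ‖w‖ ^ (n + 1)) := by
    refine Asymptotics.IsBigO.of_bound (∑' k, 2 ^ (n + 1) * ((1 / 2 : ℝ) ^ k * ‖c k‖)) ?_
    filter_upwards [Metric.ball_mem_nhds (0 : ℂ) (show (0 : ℝ) < 1 / 2 by norm_num)] with x hx
    have hx1 : ‖x‖ < 1 / 2 := by simpa using hx
    have hsum := ((hs (1 / 2) (by norm_num) (by norm_num)).mul_left ((2 : ℝ) ^ (n + 1)))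
    rw [norm_pow, norm_norm, ← tsum_mul_right]
    refine tsum_of_norm_bounded (hsum.mul_right _).hasSum ?_
    intro k
    rw [norm_mul, norm_pow]
    by_cases hk : k < n + 1
    · simp [hz k hk]
    · obtain ⟨j, rfl⟩ := Nat.exists_eq_add_of_le (not_lt.1 hk)
      have e : (2 : ℝ) ^ (n + 1) * ((1 / 2) ^ (n + 1 + j) * ‖c (n + 1 + j)‖) * ‖x‖ ^ (n + 1) =
          ‖x‖ ^ (n + 1) * (1 / 2) ^ j * ‖c (n + 1 + j)‖ := by
        rw [pow_add (1 / 2 : ℝ), one_div, inv_pow]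
        field_simp
      rw [e, pow_add]
      gcongr
  have ho : (fun w => F w - F 0) =o[𝓝 0] (fun w : ℂ => ‖w - 0‖ ^ n) := by
    simp only [hF0, sub_zero]
    exact hO.trans_isLittleO (Asymptotics.isLittleO_norm_pow_norm_pow (Nat.lt_succ_self n))
  have h := Complex.dist_le_mul_div_pow_of_mapsTo_ball_of_isLittleO (R₂ := R) (z := z) hd ?_ ho
    (by simpa using hz1)
  · simpa [hF0] using h
  · intro x hx
    have hx1 : ‖x‖ < 1 := by simpa using hx
    rw [hF0]
    simpa using hb x hx1

lemma schwarz (w : ℕ → ℍ[ℝ]) (n : ℕ) (hw : SBnClass (n + 1) w) (q : ℍ[ℝ]) (hq : ‖q‖ < 1) :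
    ‖sliceVal w q‖ ≤ ‖q‖ ^ (n + 1) := by
  obtain ⟨hsb, hz, -⟩ := hw
  obtain ⟨K, y, hre, hn, hqe⟩ := exists_slice q
  set u := sliceVal w q with hu
  set c : ℕ → ℂ := fun k => psi K u (w k) with hc
  have hpow : ∀ (z : ℂ) (k : ℕ) (x : ℍ[ℝ]), psi K u (Qe K z ^ k * x) = z ^ k * psi K u x := by
    intro z k
    induction k with
    | zero => intro x; simp
    | succ k ih =>
      intro x
      rw [pow_succ, mul_assoc, ih, psi_Qe K u hre hn]; ring
  have hval : ∀ z : ℂ, ‖z‖ < 1 → ∑' k, z ^ k * c k = psi K u (sliceVal w (Qe K z)) := by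
    intro z hz
    have h1 := (hsb.1 (Qe K z) (by rw [Qe_norm K hre hn]; exact hz)).hasSum
    have h2 := (LinearMap.toContinuousLinearMap (psi K u)).hasSum h1
    have h3 := h2.tsum_eq
    simp only [LinearMap.coe_toContinuousLinearMap', Function.comp_def, hpow] at h3
    exact h3
  have h := complex_schwarz c n ‖u‖ ?_ ?_ ?_ ⟨q.re, y⟩ ?_
  · have hQ : Qe K ⟨q.re, y⟩ = q := hqe.symm
    have hnz : ‖(⟨q.re, y⟩ : ℂ)‖ = ‖q‖ := by rw [← Qe_norm K hre hn, hQ]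
    rw [hval _ (by rw [hnz]; exact hq), hQ, ← hu, psi_self K u hre, hnz] at h
    rcases (norm_nonneg u).eq_or_lt with h0 | h0
    · rw [← h0]; positivity
    · rw [sq] at h
      exact le_of_mul_le_mul_left h h0
  · intro r h0 h1
    refine Summable.of_nonneg_of_le (fun k => by positivity) (fun k => ?_)
      ((summable_norm_coeff w hsb.1 r h0 h1).mul_right ‖u‖)
    rw [mul_assoc]
    gcongr
    exact psi_norm K u hre hn _
  · intro j hj
    simp [hc, hz j hj]
  · intro z hz
    rw [hval z hz]
    refine (psi_norm K u hre hn _).trans ?_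
    have := hsb.2 (Qe K z) (by rw [Qe_norm K hre hn]; exact hz)
    nlinarith [norm_nonneg u]
  · have hQ : Qe K ⟨q.re, y⟩ = q := hqe.symm
    rw [← Qe_norm K hre hn, hQ]; exact hq

end BohrAux

namespace BohrAux

open Finset Filter Topology

lemma finite_bound (b : ℕ → ℝ) (r : ℝ) (hr0 : 0 ≤ r) (hr1 : r < 1) (hb : ∀ k, 0 ≤ b k)
    (hodd : ∀ n, b (2 * n + 1) ≤ 1 - ∑ k ∈ range (n + 1), b k ^ 2)
    (heven : ∀ n, b (2 * n + 2) ≤ 1 - ∑ k ∈ range (n + 1), b k ^ 2 - b (n + 1) ^ 2 / (1 + b 0))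
    (M : ℕ) :
    ∑ k ∈ range (2 * M), r ^ (k + 1) * b (k + 1) +
      (1 / (1 + b 0) + r / (1 - r)) * ∑ k ∈ range M, (r ^ (k + 1)) ^ 2 * b (k + 1) ^ 2 ≤
      (1 - b 0 ^ 2) * (r / (1 - r)) := by
  have h1r : 0 < 1 - r := by linarith
  have hS : ∀ M, ∑ k ∈ range (M + 1), b k ^ 2 = ∑ k ∈ range M, b (k + 1) ^ 2 + b 0 ^ 2 := by
    intro M
    rw [sum_range_succ']
  have key : ∑ k ∈ range (2 * M), r ^ (k + 1) * b (k + 1) +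
      (1 / (1 + b 0) + r / (1 - r)) * ∑ k ∈ range M, (r ^ (k + 1)) ^ 2 * b (k + 1) ^ 2 ≤
      (1 - b 0 ^ 2) * (r / (1 - r)) * (1 - r ^ (2 * M)) +
        r ^ (2 * M) * (r / (1 - r)) * ∑ k ∈ range M, b (k + 1) ^ 2 := by
    induction M with
    | zero => simp
    | succ M ih =>
      rw [show 2 * (M + 1) = 2 * M + 1 + 1 by ring, sum_range_succ, sum_range_succ,
        sum_range_succ, sum_range_succ]
      have ho := hodd M
      have he := heven M
      rw [hS] at ho he
      set S := ∑ k ∈ range M, b (k + 1) ^ 2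
      set X := ∑ k ∈ range (2 * M), r ^ (k + 1) * b (k + 1)
      set Y := ∑ k ∈ range M, (r ^ (k + 1)) ^ 2 * b (k + 1) ^ 2
      have e1 := mul_le_mul_of_nonneg_left ho (pow_nonneg hr0 (2 * M + 1))
      have e2 := mul_le_mul_of_nonneg_left he (pow_nonneg hr0 (2 * M + 2))
      set ρ := r / (1 - r) with hρ
      have hρ1 : ρ * (1 - r) = r := by rw [hρ]; field_simp
      rw [show 2 * M + 1 + 1 = 2 * M + 2 by ring]
      have e3 : (r ^ (M + 1)) ^ 2 = r ^ (2 * M + 2) := by ring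
      rw [e3]
      set T := r ^ (2 * M) with hT
      have t1 : r ^ (2 * M + 1) = T * r := by rw [hT]; ring
      have t2 : r ^ (2 * M + 2) = T * r ^ 2 := by rw [hT]; ring
      rw [t1] at e1 ⊢
      rw [t2] at e2 ⊢
      have hA : (1 - b 0 ^ 2) * ρ * (1 - T * r ^ 2) + T * r ^ 2 * ρ * (S + b (M + 1) ^ 2) =
          ((1 - b 0 ^ 2) * ρ * (1 - T) + T * ρ * S) +
            (T * r * (1 - (S + b 0 ^ 2)) + T * r ^ 2 *
              (1 - (S + b 0 ^ 2) - b (M + 1) ^ 2 / (1 + b 0))) +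
            (1 / (1 + b 0) + ρ) * (T * r ^ 2 * b (M + 1) ^ 2) := by
        linear_combination (T * (1 + r) * (1 - b 0 ^ 2 - S)) * hρ1
      rw [hA]
      linarith
  refine key.trans ?_
  have hbd : ∑ k ∈ range M, b (k + 1) ^ 2 ≤ 1 - b 0 ^ 2 := by
    have := hodd M
    rw [hS] at this
    linarith [hb (2 * M + 1)]
  have hc : 0 ≤ r ^ (2 * M) * (r / (1 - r)) := by positivity
  nlinarith [mul_le_mul_of_nonneg_left hbd hc]

lemma bernoulli (a m : ℝ) (ha : 0 ≤ a) (hm0 : 0 < m) (hm1 : m ≤ 1) :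
    a ^ m ≤ 1 - m / 2 * (1 - a ^ 2) := by
  have h := rpow_one_add_le_one_add_mul_self (s := a ^ 2 - 1) (p := m / 2)
    (by nlinarith [sq_nonneg a]) (by linarith) (by linarith)
  have e : (1 + (a ^ 2 - 1)) ^ (m / 2) = a ^ m := by
    rw [add_sub_cancel, ← Real.rpow_natCast, ← Real.rpow_mul ha]
    congr 1
    push_cast
    ring
  rw [e] at h
  linarith

end BohrAux

namespace BohrAux

open Finset Filter Topology

theorem bohr_main (m : ℝ) (hm0 : 0 < m) (hm1 : m ≤ 1)
    (p : ℕ → ℍ[ℝ]) (hp : SBClass p)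
    (w : ℕ → ℕ → ℍ[ℝ]) (hw : ∀ k, 1 ≤ k → SBnClass k (w k))
    (q : ℍ[ℝ]) (hq : ‖q‖ < 1) (hqr : ‖q‖ ≤ m / (m + 2)) :
    ‖p 0‖ ^ m + (∑' k : ℕ, ‖sliceVal (w (k + 1)) q‖ * ‖p (k + 1)‖) +
      (1 / (1 + ‖p 0‖) + ‖sliceVal (w 1) q‖ / (1 - ‖sliceVal (w 1) q‖)) *
        ∑' k : ℕ, ‖sliceVal (w (k + 1)) q‖ ^ 2 * ‖p (k + 1)‖ ^ 2 ≤ 1 := by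
  set b : ℕ → ℝ := fun k => ‖p k‖ with hb
  set t : ℕ → ℝ := fun k => ‖sliceVal (w (k + 1)) q‖ with ht
  set r := ‖q‖ with hr
  have hr0 : 0 ≤ r := norm_nonneg q
  have hb0 : ∀ k, 0 ≤ b k := fun k => norm_nonneg _
  have ht0 : ∀ k, 0 ≤ t k := fun k => norm_nonneg _
  have htr : ∀ k, t k ≤ r ^ (k + 1) := fun k =>
    schwarz (w (k + 1)) k (hw (k + 1) (by omega)) q hq
  have hb1 : ∀ k, b k ≤ 1 := by
    intro k
    have h := fun n => carlson_odd p hp n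
    have h1 := h k
    have h2 : b k ^ 2 ≤ ∑ j ∈ range (k + 1), ‖p j‖ ^ 2 :=
      single_le_sum (f := fun j => ‖p j‖ ^ 2) (fun _ _ => by positivity)
        (mem_range.2 (Nat.lt_succ_self k))
    have h3 := norm_nonneg (p (2 * k + 1))
    nlinarith [hb0 k]
  have h1r : 0 < 1 - r := by linarith
  have ht1 : t 0 ≤ r := by simpa using htr 0
  have hcoef : t 0 / (1 - t 0) ≤ r / (1 - r) := by
    apply div_le_div₀ hr0 ht1 h1r (by linarith)
  have hfin : ∀ M, ∑ k ∈ range (2 * M), t k * b (k + 1) +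
      (1 / (1 + b 0) + t 0 / (1 - t 0)) * ∑ k ∈ range M, t k ^ 2 * b (k + 1) ^ 2 ≤
      (1 - b 0 ^ 2) * (r / (1 - r)) := by
    intro M
    refine le_trans ?_ (finite_bound b r hr0 hq hb0 (fun n => carlson_odd p hp n)
      (fun n => carlson_even p hp n) M)
    have hx : 0 ≤ 1 / (1 + b 0) + r / (1 - r) := by
      have := hb0 0
      positivity
    apply add_le_add
    · exact sum_le_sum fun k _ => mul_le_mul_of_nonneg_right (htr k) (hb0 _)
    · apply mul_le_mul
      · linarith
      · exact sum_le_sum fun k _ => mul_le_mul_of_nonneg_right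
          (pow_le_pow_left₀ (ht0 k) (htr k) 2) (by positivity)
      · exact sum_nonneg fun k _ => by positivity
      · exact hx
  have hgeo : Summable fun k : ℕ => r ^ (k + 1) :=
    (summable_nat_add_iff 1).2 (summable_geometric_of_lt_one hr0 hq)
  have hle : ∀ k, t k * b (k + 1) ≤ r ^ (k + 1) := fun k => by
    have := mul_le_mul (htr k) (hb1 (k + 1)) (hb0 _) (by positivity)
    simpa using this
  have hs1 : Summable fun k => t k * b (k + 1) :=
    Summable.of_nonneg_of_le (fun k => mul_nonneg (ht0 k) (hb0 _)) hle hgeo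
  have hs2 : Summable fun k => t k ^ 2 * b (k + 1) ^ 2 := by
    refine Summable.of_nonneg_of_le (fun k => by positivity) (fun k => ?_) hgeo
    rw [← mul_pow]
    have h0 := mul_nonneg (ht0 k) (hb0 (k + 1))
    have h2 : r ^ (k + 1) ≤ 1 := pow_le_one₀ hr0 hq.le
    nlinarith [hle k]
  have hlim := ((hs1.hasSum.tendsto_sum_nat.comp
    (tendsto_id.const_mul_atTop' (show 0 < 2 by norm_num))).add
    (hs2.hasSum.tendsto_sum_nat.const_mul (1 / (1 + b 0) + t 0 / (1 - t 0))))
  have hmain := le_of_tendsto' hlim hfin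
  have hbern := bernoulli (b 0) m (hb0 0) hm0 hm1
  have hrm : r / (1 - r) ≤ m / 2 := by
    rw [div_le_div_iff₀ h1r (by norm_num)]
    rw [le_div_iff₀ (by linarith)] at hqr
    linarith
  have h3 : (1 - b 0 ^ 2) * (r / (1 - r)) ≤ (1 - b 0 ^ 2) * (m / 2) := by
    apply mul_le_mul_of_nonneg_left hrm
    nlinarith [hb0 0, hb1 0]
  change b 0 ^ m + (∑' k, t k * b (k + 1)) + (1 / (1 + b 0) + t 0 / (1 - t 0)) *
    ∑' k, t k ^ 2 * b (k + 1) ^ 2 ≤ 1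
  linarith

end BohrAux

theorem bohr_refined (m : ℝ) (hm0 : 0 < m) (hm1 : m ≤ 1)
    (p : ℕ → ℍ[ℝ]) (hp : SBClass p)
    (w : ℕ → ℕ → ℍ[ℝ]) (hw : ∀ k, 1 ≤ k → SBnClass k (w k))
    (q : ℍ[ℝ]) (hq : ‖q‖ < 1) (hqr : ‖q‖ ≤ m / (m + 2)) :
    ‖p 0‖ ^ m + (∑' k : ℕ, ‖sliceVal (w (k + 1)) q‖ * ‖p (k + 1)‖) +
      (1 / (1 + ‖p 0‖) + ‖sliceVal (w 1) q‖ / (1 - ‖sliceVal (w 1) q‖)) *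
        ∑' k : ℕ, ‖sliceVal (w (k + 1)) q‖ ^ 2 * ‖p (k + 1)‖ ^ 2 ≤ 1 :=
  BohrAux.bohr_main m hm0 hm1 p hp w hw q hq hqr
end
end

section
/- The constant m/(m+2) in the refined Bohr theorem is best possible: for every m ∈ (0,1] and every r with m/(m+2) < r < 1, there exist a function f(q) = ∑_{k=0}^∞ qᵏ pₖ ∈ SB(𝔹), functions ωₖ ∈ SB_k(𝔹) for k ≥ 1, and a point q ∈ 𝔹 with |q| = r such that |p₀|^m + ∑_{k=1}^∞ |ωₖ(q)| |pₖ| + (1/(1+|p₀|) + |ω₁(q)|/(1−|ω₁(q)|)) · ∑_{k=1}^∞ |ωₖ(q)|² |pₖ|² > 1 (for instance ωₖ(q) = qᵏ and f = f_a with p₀ = a, pₖ = −(1−a²)a^{k−1} for k ≥ 1, for which this quantity equals a^m + (1−a²)r/(1−r), for a ∈ (0,1) close enough to 1). -/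
noncomputable section
open scoped Quaternion

/-- Coefficients of the extremal function `(a - q) (1 - a q)⁻¹`. -/
def extCoeff (a : ℝ) : ℕ → ℍ[ℝ]
  | 0 => ((a : ℝ) : ℍ[ℝ])
  | k + 1 => ((-((1 - a ^ 2) * a ^ k) : ℝ) : ℍ[ℝ])

lemma ext_hasSum (a : ℝ) (ha0 : 0 < a) (ha1 : a < 1) (q : ℍ[ℝ]) (hq : ‖q‖ < 1) :
    HasSum (fun k : ℕ => q ^ k * extCoeff a k)
      ((a : ℍ[ℝ]) + (-(1 - a ^ 2)) • (q * (1 - a • q)⁻¹)) := by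
  have hn : ‖a • q‖ < 1 := by
    rw [norm_smul, Real.norm_of_nonneg ha0.le]
    nlinarith [norm_nonneg q]
  have h := ((hasSum_geometric_of_norm_lt_one hn).mul_left q).const_smul (-(1 - a ^ 2))
  rw [← hasSum_nat_add_iff' 1]
  convert h using 1
  · rfl
  · funext k
    simp only [extCoeff, smul_pow, Quaternion.mul_coe_eq_smul, mul_smul_comm, pow_succ', smul_smul]
    congr 1
    ring
  · simp [extCoeff]

lemma ext_norm (a : ℝ) (ha0 : 0 < a) (ha1 : a < 1) (q : ℍ[ℝ]) (hq : ‖q‖ < 1) :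
    ‖(a : ℍ[ℝ]) + (-(1 - a ^ 2)) • (q * (1 - a • q)⁻¹)‖ < 1 := by
  have hn : ‖a • q‖ < 1 := by
    rw [norm_smul, Real.norm_of_nonneg ha0.le]
    nlinarith [norm_nonneg q]
  have hne : (1 - a • q) ≠ 0 := by
    intro h
    rw [sub_eq_zero] at h
    rw [← h] at hn
    simp at hn
  have e : (a : ℍ[ℝ]) + (-(1 - a ^ 2)) • (q * (1 - a • q)⁻¹)
      = ((a : ℍ[ℝ]) - q) * (1 - a • q)⁻¹ := by
    have : (a : ℍ[ℝ]) = ((a : ℍ[ℝ]) * (1 - a • q)) * (1 - a • q)⁻¹ := by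
      rw [mul_inv_cancel_right₀ hne]
    nth_rewrite 1 [this]
    rw [← smul_mul_assoc, ← add_mul]
    congr 1
    rw [Quaternion.coe_mul_eq_smul, smul_sub, smul_smul, ← Quaternion.coe_mul_eq_smul, mul_one]
    module
  rw [e, norm_mul, norm_inv, ← div_eq_mul_inv, div_lt_one (norm_pos_iff.2 hne)]
  apply lt_of_pow_lt_pow_left₀ 2 (norm_nonneg _)
  have hq2 : ‖q‖ ^ 2 < 1 := by nlinarith [norm_nonneg q]
  rw [sq, sq, ← Quaternion.normSq_eq_norm_mul_self, ← Quaternion.normSq_eq_norm_mul_self]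
  rw [sq, ← Quaternion.normSq_eq_norm_mul_self] at hq2
  simp only [Quaternion.normSq_def'] at *
  simp
  nlinarith [mul_pos (sub_pos.2 hq2) (show 0 < 1 - a ^ 2 by nlinarith)]

lemma ext_SB (a : ℝ) (ha0 : 0 < a) (ha1 : a < 1) : SBClass (extCoeff a) := by
  refine ⟨fun q hq => (ext_hasSum a ha0 ha1 q hq).summable, fun q hq => ?_⟩
  rw [sliceVal, (ext_hasSum a ha0 ha1 q hq).tsum_eq]
  exact ext_norm a ha0 ha1 q hq

/-- Coefficients of the monomial `q ^ k`. -/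
def monoCoeff (k : ℕ) : ℕ → ℍ[ℝ] := fun j => if j = k then 1 else 0

lemma mono_hasSum (k : ℕ) (q : ℍ[ℝ]) :
    HasSum (fun j : ℕ => q ^ j * monoCoeff k j) (q ^ k) := by
  have h := hasSum_single (f := fun j : ℕ => q ^ j * monoCoeff k j) k
    (fun j hj => by simp [monoCoeff, hj])
  simpa [monoCoeff] using h

lemma mono_val (k : ℕ) (q : ℍ[ℝ]) : sliceVal (monoCoeff k) q = q ^ k :=
  (mono_hasSum k q).tsum_eq

lemma mono_SBn (k : ℕ) (hk : 1 ≤ k) : SBnClass k (monoCoeff k) := by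
  refine ⟨⟨fun q _ => (mono_hasSum k q).summable, fun q hq => ?_⟩, fun j hj => ?_, ?_⟩
  · rw [mono_val, norm_pow]
    exact pow_lt_one₀ (norm_nonneg _) hq (by omega)
  · simp [monoCoeff, hj.ne]
  · simp [monoCoeff]

lemma exists_a (m R : ℝ) (hm0 : 0 < m) (hm1 : m ≤ 1) (hR : m < 2 * R) :
    ∃ a : ℝ, 0 < a ∧ a < 1 ∧ 1 < a ^ m + (1 - a ^ 2) * R := by
  have hR0 : 0 < R := by linarith
  obtain ⟨s, hs⟩ : ∃ s, s = m / (2 * R) := ⟨_, rfl⟩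
  have hsR : s * (2 * R) = m := by rw [hs]; field_simp
  have hs0 : 0 < s := by rw [hs]; positivity
  have hs1 : s < 1 := by rw [hs, div_lt_one (by positivity)]; exact hR
  obtain ⟨a, ha⟩ : ∃ a, a = (1 + s) / 2 := ⟨_, rfl⟩
  have ha0 : 0 < a := by linarith
  have ha1 : a < 1 := by linarith
  have hsa : s < a ^ 2 := by rw [ha]; nlinarith [mul_pos (sub_pos.2 hs1) (sub_pos.2 hs1)]
  refine ⟨a, ha0, ha1, ?_⟩
  have hinv : 1 < a⁻¹ := (one_lt_inv₀ ha0).2 ha1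
  have hb := rpow_one_add_le_one_add_mul_self (s := a⁻¹ - 1) (by linarith) hm0.le hm1
  rw [add_sub_cancel, Real.inv_rpow ha0.le] at hb
  have hp : 0 < a ^ m := Real.rpow_pos_of_pos ha0 m
  have hb2 : 1 ≤ a ^ m * (1 + m * (a⁻¹ - 1)) := by
    calc (1 : ℝ) = a ^ m * (a ^ m)⁻¹ := (mul_inv_cancel₀ hp.ne').symm
      _ ≤ _ := by gcongr
  have hple : a ^ m ≤ 1 := Real.rpow_le_one ha0.le ha1.le hm0.le
  -- 1 - a^m ≤ m (1/a - 1)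
  have h3 : 1 - a ^ m ≤ m * (a⁻¹ - 1) := by
    nlinarith [mul_pos hm0 (sub_pos.2 hinv)]
  have h4 : m * (a⁻¹ - 1) * a = m * (1 - a) := by field_simp
  have h5 : m * (a⁻¹ - 1) < (1 - a ^ 2) * R := by
    apply lt_of_mul_lt_mul_right _ ha0.le
    rw [h4, ← hsR]
    have h6 : 2 * s < (1 + a) * a := by nlinarith
    nlinarith [mul_pos (mul_pos hR0 (sub_pos.2 ha1)) (sub_pos.2 h6)]
  linarith

theorem bohr_refined_sharp (m : ℝ) (hm0 : 0 < m) (hm1 : m ≤ 1)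
    (r : ℝ) (hr1 : m / (m + 2) < r) (hr2 : r < 1) :
    ∃ (p : ℕ → ℍ[ℝ]) (w : ℕ → ℕ → ℍ[ℝ]) (q : ℍ[ℝ]),
      SBClass p ∧ (∀ k, 1 ≤ k → SBnClass k (w k)) ∧ ‖q‖ = r ∧
      1 < ‖p 0‖ ^ m + (∑' k : ℕ, ‖sliceVal (w (k + 1)) q‖ * ‖p (k + 1)‖) +
        (1 / (1 + ‖p 0‖) + ‖sliceVal (w 1) q‖ / (1 - ‖sliceVal (w 1) q‖)) *
          ∑' k : ℕ, ‖sliceVal (w (k + 1)) q‖ ^ 2 * ‖p (k + 1)‖ ^ 2 := by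
  have hr0 : 0 < r := lt_trans (by positivity) hr1
  have h1r : 0 < 1 - r := by linarith
  have hR : m < 2 * (r / (1 - r)) := by
    rw [div_lt_iff₀ (by linarith)] at hr1
    rw [← mul_div_assoc, lt_div_iff₀ h1r]
    nlinarith
  obtain ⟨a, ha0, ha1, ha⟩ := exists_a m _ hm0 hm1 hR
  have hq : ‖((r : ℝ) : ℍ[ℝ])‖ = r := by
    rw [Quaternion.norm_coe, Real.norm_of_nonneg hr0.le]
  refine ⟨extCoeff a, monoCoeff, (r : ℍ[ℝ]), ext_SB a ha0 ha1, mono_SBn, hq, ?_⟩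
  have h1a : 0 < 1 - a ^ 2 := by nlinarith
  have hp0 : ‖extCoeff a 0‖ = a := by
    simp only [extCoeff]
    rw [Quaternion.norm_coe, Real.norm_of_nonneg ha0.le]
  have hpk : ∀ k, ‖extCoeff a (k + 1)‖ = (1 - a ^ 2) * a ^ k := by
    intro k
    simp only [extCoeff]
    rw [Quaternion.norm_coe, norm_neg, Real.norm_of_nonneg (by positivity)]
  have har : a * r < 1 := by nlinarith
  have har0 : 0 < a * r := by positivity
  have har2 : (a * r) ^ 2 < 1 := by nlinarith
  have s1 : (∑' k : ℕ, r ^ (k + 1) * ((1 - a ^ 2) * a ^ k))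
      = (1 - a ^ 2) * r * (1 - a * r)⁻¹ := by
    rw [← tsum_geometric_of_lt_one har0.le har, ← tsum_mul_left]
    congr 1; funext k; ring
  have s2 : (∑' k : ℕ, (r ^ (k + 1)) ^ 2 * ((1 - a ^ 2) * a ^ k) ^ 2)
      = ((1 - a ^ 2) * r) ^ 2 * (1 - (a * r) ^ 2)⁻¹ := by
    rw [← tsum_geometric_of_lt_one (by positivity) har2, ← tsum_mul_left]
    congr 1; funext k; ring
  simp only [mono_val, norm_pow, hq, hp0, hpk, s1, s2, pow_one]
  refine lt_of_lt_of_eq ha ?_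
  rw [add_assoc]
  congr 1
  have e1 : 1 - a * r ≠ 0 := by linarith
  have e2 : 1 + a * r ≠ 0 := by positivity
  have e3 : 1 + a ≠ 0 := by positivity
  have e4 : 1 - r ≠ 0 := h1r.ne'
  have e5 : 1 - (a * r) ^ 2 = (1 - a * r) * (1 + a * r) := by ring
  rw [e5]
  field_simp
  ring
end
end

section
/- Let m ∈ (0,1], let f(q) = ∑_{k=0}^∞ qᵏ pₖ belong to SB(𝔹), let ωₖ ∈ SB_k(𝔹) for k ≥ 1, let N ≥ 1, and let d₁, …, d_N ≥ 0 satisfy 8 d₁ M_m² + ∑_{k=2}^N 2(2k−1) c_k d_k M_m^{2k} ≤ m, where M_m = m(2+m)/(4(m+1)) and c_k = max_{x∈[0,1]} x(1+x)²(1−x²)^{2k−2}. Then, writing S*_q = ∑_{k=1}^∞ k |q|^{2k} |pₖ|², one has |p₀|^m + ∑_{k=1}^∞ |ωₖ(q)| |pₖ| + ∑_{i=1}^N d_i (S*_q)^i ≤ 1 for every q ∈ 𝔹 with |q| ≤ m/(2+m). -/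
noncomputable section
open scoped Quaternion

/-- `c_k = max_{x ∈ [0,1]} x (1+x)² (1−x²)^{2k−2}`. -/
noncomputable def cmax (k : ℕ) : ℝ :=
  sSup ((fun x : ℝ => x * (1 + x) ^ 2 * (1 - x ^ 2) ^ (2 * k - 2)) '' Set.Icc 0 1)

/-- `M_m = m(2+m)/(4(m+1))`. -/
noncomputable def Mconst (m : ℝ) : ℝ := m * (2 + m) / (4 * (m + 1))

/-- The quantity `S*_q = ∑_{k≥1} k |q|^{2k} |p_k|²`. -/
noncomputable def Sstar (p : ℕ → ℍ[ℝ]) (q : ℍ[ℝ]) : ℝ :=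
  ∑' k : ℕ, ((k : ℝ) + 1) * ‖q‖ ^ (2 * (k + 1)) * ‖p (k + 1)‖ ^ 2

def BS (b : ℕ → ℂ) : Prop :=
  ∀ z : ℂ, ‖z‖ < 1 → Summable (fun j => z ^ j * b j) ∧ ‖∑' j, z ^ j * b j‖ ≤ 1

def GoodI (I : ℍ[ℝ]) : Prop := I.re = 0 ∧ I.imI ^ 2 + I.imJ ^ 2 + I.imK ^ 2 = 1

def phi (I : ℍ[ℝ]) (z : ℂ) : ℍ[ℝ] :=
  ⟨z.re, z.im * I.imI, z.im * I.imJ, z.im * I.imK⟩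

def ppi (I : ℍ[ℝ]) : ℍ[ℝ] →+ ℂ where
  toFun h := ⟨h.re, I.imI * h.imI + I.imJ * h.imJ + I.imK * h.imK⟩
  map_zero' := by apply Complex.ext <;> simp
  map_add' x y := by apply Complex.ext <;> simp <;> ring

lemma ppi_cont (I : ℍ[ℝ]) : Continuous (ppi I) := by
  have : (ppi I : ℍ[ℝ] → ℂ) = fun h => ((h.re : ℝ) : ℂ) +
      ((I.imI * h.imI + I.imJ * h.imJ + I.imK * h.imK : ℝ) : ℂ) * Complex.I := by
    funext h
    apply Complex.ext <;> simp [ppi]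
  rw [this]
  have h1 := Quaternion.continuous_re
  have h2 := Quaternion.continuous_imI
  have h3 := Quaternion.continuous_imJ
  have h4 := Quaternion.continuous_imK
  fun_prop

lemma phi_re (I : ℍ[ℝ]) (z : ℂ) : (phi I z).re = z.re := rfl
lemma phi_imI (I : ℍ[ℝ]) (z : ℂ) : (phi I z).imI = z.im * I.imI := rfl
lemma phi_imJ (I : ℍ[ℝ]) (z : ℂ) : (phi I z).imJ = z.im * I.imJ := rfl
lemma phi_imK (I : ℍ[ℝ]) (z : ℂ) : (phi I z).imK = z.im * I.imK := rfl

lemma phi_mul {I : ℍ[ℝ]} (hI : GoodI I) (z w : ℂ) : phi I (z * w) = phi I z * phi I w := by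
  obtain ⟨_, h⟩ := hI
  apply Quaternion.ext <;> simp [phi_re, phi_imI, phi_imJ, phi_imK] <;> first | (ring; done) | linear_combination (z.im * w.im) * h

lemma phi_one (I : ℍ[ℝ]) : phi I 1 = 1 := by
  apply Quaternion.ext <;> simp [phi]

lemma phi_pow {I : ℍ[ℝ]} (hI : GoodI I) (z : ℂ) (n : ℕ) : phi I (z ^ n) = phi I z ^ n := by
  induction n with
  | zero => simp [phi_one]
  | succ n ih => rw [pow_succ, pow_succ, phi_mul hI, ih]

lemma ppi_phi_mul {I : ℍ[ℝ]} (hI : GoodI I) (z : ℂ) (h : ℍ[ℝ]) :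
    ppi I (phi I z * h) = z * ppi I h := by
  obtain ⟨_, h1⟩ := hI
  apply Complex.ext <;> simp [phi_re, phi_imI, phi_imJ, phi_imK, ppi]
  · ring
  · linear_combination (z.im * h.re) * h1

lemma norm_sq_quat (h : ℍ[ℝ]) : ‖h‖ ^ 2 = h.re ^ 2 + h.imI ^ 2 + h.imJ ^ 2 + h.imK ^ 2 := by
  rw [sq, ← Quaternion.normSq_eq_norm_mul_self, Quaternion.normSq_def']

lemma norm_phi {I : ℍ[ℝ]} (hI : GoodI I) (z : ℂ) : ‖phi I z‖ = ‖z‖ := by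
  obtain ⟨_, h1⟩ := hI
  rw [← sq_eq_sq₀ (norm_nonneg _) (norm_nonneg _), norm_sq_quat, Complex.sq_norm,
    Complex.normSq_apply]
  simp only [phi]
  linear_combination z.im ^ 2 * h1

lemma norm_ppi {I : ℍ[ℝ]} (hI : GoodI I) (h : ℍ[ℝ]) : ‖ppi I h‖ ≤ ‖h‖ := by
  obtain ⟨_, h1⟩ := hI
  rw [← sq_le_sq₀ (norm_nonneg _) (norm_nonneg _), norm_sq_quat, Complex.sq_norm,
    Complex.normSq_apply]
  simp only [ppi, AddMonoidHom.coe_mk, ZeroHom.coe_mk]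
  have key : (I.imI * h.imI + I.imJ * h.imJ + I.imK * h.imK) ^ 2 ≤
      (I.imI ^ 2 + I.imJ ^ 2 + I.imK ^ 2) * (h.imI ^ 2 + h.imJ ^ 2 + h.imK ^ 2) := by
    nlinarith [sq_nonneg (I.imI * h.imJ - I.imJ * h.imI), sq_nonneg (I.imI * h.imK - I.imK * h.imI),
      sq_nonneg (I.imJ * h.imK - I.imK * h.imJ)]
  rw [h1] at key
  nlinarith

lemma ppi_phi {I : ℍ[ℝ]} (hI : GoodI I) (z : ℂ) : ppi I (phi I z) = z := by
  have := ppi_phi_mul hI z 1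
  rw [mul_one] at this
  rw [this]
  have : ppi I 1 = 1 := by apply Complex.ext <;> simp [ppi]
  rw [this, mul_one]

lemma ppi_real (I : ℍ[ℝ]) (a : ℝ) : ppi I (a : ℍ[ℝ]) = (a : ℂ) := by
  apply Complex.ext <;> simp [ppi]

lemma exists_slice (h : ℍ[ℝ]) : ∃ I, GoodI I ∧ ∃ z, phi I z = h := by
  set v := Real.sqrt (h.imI ^ 2 + h.imJ ^ 2 + h.imK ^ 2) with hv
  have hv2 : v ^ 2 = h.imI ^ 2 + h.imJ ^ 2 + h.imK ^ 2 := Real.sq_sqrt (by positivity)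
  by_cases h0 : v = 0
  · rw [h0] at hv2
    have h1 : h.imI = 0 := by nlinarith [sq_nonneg h.imI, sq_nonneg h.imJ, sq_nonneg h.imK]
    have h2 : h.imJ = 0 := by nlinarith [sq_nonneg h.imI, sq_nonneg h.imJ, sq_nonneg h.imK]
    have h3 : h.imK = 0 := by nlinarith [sq_nonneg h.imI, sq_nonneg h.imJ, sq_nonneg h.imK]
    refine ⟨⟨0, 1, 0, 0⟩, by simp [GoodI], (h.re : ℂ), ?_⟩
    apply Quaternion.ext <;> simp [phi, h1, h2, h3]
  · refine ⟨⟨0, h.imI / v, h.imJ / v, h.imK / v⟩, ⟨rfl, ?_⟩, ⟨h.re, v⟩, ?_⟩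
    · simp only
      field_simp
      exact hv2.symm
    · apply Quaternion.ext <;> simp [phi] <;> field_simp

lemma exists_rot (v : ℍ[ℝ]) : ∃ u : ℍ[ℝ], ‖u‖ = 1 ∧ v * u = ((‖v‖ : ℝ) : ℍ[ℝ]) := by
  by_cases h : v = 0
  · exact ⟨1, by simp, by simp [h]⟩
  · have hn : ‖v‖ ≠ 0 := norm_ne_zero_iff.mpr h
    refine ⟨v⁻¹ * ((‖v‖ : ℝ) : ℍ[ℝ]), ?_, ?_⟩
    · rw [norm_mul, norm_inv, Quaternion.norm_coe, norm_norm, inv_mul_cancel₀ hn]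
    · rw [← mul_assoc, mul_inv_cancel₀ h, one_mul]

lemma slice_hasSum {p : ℕ → ℍ[ℝ]} (hp : SBClass p) {I : ℍ[ℝ]} (hI : GoodI I) (u : ℍ[ℝ])
    {z : ℂ} (hz : ‖z‖ < 1) :
    HasSum (fun j => z ^ j * ppi I (p j * u)) (ppi I (sliceVal p (phi I z) * u)) := by
  have h1 := (hp.1 (phi I z) (by rwa [norm_phi hI])).hasSum
  have h2 := (h1.mul_right u).map (ppi I) (ppi_cont I)
  refine h2.congr_fun ?_ |> fun h => h
  intro j
  simp only [Function.comp]
  rw [mul_assoc, ← phi_pow hI, ppi_phi_mul hI]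

lemma slice_BS {p : ℕ → ℍ[ℝ]} (hp : SBClass p) {I : ℍ[ℝ]} (hI : GoodI I) {u : ℍ[ℝ]}
    (hu : ‖u‖ = 1) : BS (fun j => ppi I (p j * u)) := by
  intro z hz
  have h := slice_hasSum hp hI u hz
  refine ⟨h.summable, ?_⟩
  rw [h.tsum_eq]
  refine (norm_ppi hI _).trans ?_
  rw [norm_mul, hu, mul_one]
  exact (hp.2 _ (by rwa [norm_phi hI])).le

lemma BS_fps {b : ℕ → ℂ} (hb : BS b) :
    HasFPowerSeriesOnBall (fun z => ∑' j, z ^ j * b j) (FormalMultilinearSeries.ofScalars ℂ b) 0 1 := by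
  constructor
  · refine le_of_forall_lt_imp_le_of_dense fun r hr ↦ ?_
    lift r to NNReal using hr.ne_top
    apply FormalMultilinearSeries.le_radius_of_summable
    simpa [smul_eq_mul, norm_mul, mul_comm, mul_left_comm, mul_assoc] using
      (hb (r : ℂ) (by simpa using hr)).1.norm
  · simp
  · intro y hy
    rw [← ENNReal.coe_one, Metric.eball_coe, NNReal.coe_one, mem_ball_zero_iff] at hy
    simpa [mul_comm] using (hb y hy).1.hasSum

lemma BS_diff {b : ℕ → ℂ} (hb : BS b) :
    DifferentiableOn ℂ (fun z => ∑' j, z ^ j * b j) (Metric.ball 0 1) := by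
  have := (BS_fps hb).differentiableOn
  rwa [← ENNReal.coe_one, Metric.eball_coe, NNReal.coe_one] at this

lemma BS_deriv {b : ℕ → ℂ} (hb : BS b) :
    HasDerivAt (fun z => ∑' j, z ^ j * b j) (b 1) 0 := by
  have := (BS_fps hb).hasFPowerSeriesAt.hasDerivAt
  simpa [FormalMultilinearSeries.ofScalars_apply_eq] using this

lemma tsum_zero_pow (b : ℕ → ℂ) : ∑' j, (0 : ℂ) ^ j * b j = b 0 := by
  rw [tsum_eq_single 0]
  · simp
  · intro j hj
    simp [hj]

lemma BS_succ_sum {b : ℕ → ℂ} (hb : BS b) (h0 : b 0 = 0) {z : ℂ} (hz : ‖z‖ < 1) :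
    Summable (fun j => z ^ j * b (j + 1)) ∧
    ∑' j, z ^ j * b j = z * ∑' j, z ^ j * b (j + 1) := by
  have hs := (hb z hz).1
  constructor
  · by_cases hz0 : z = 0
    · subst hz0
      refine summable_of_ne_finset_zero (s := {0}) ?_
      intro j hj
      simp at hj
      simp [hj]
    · have h1 := (summable_nat_add_iff 1).2 hs
      have h2 := h1.mul_left z⁻¹
      refine h2.congr fun j => ?_
      rw [pow_succ]
      field_simp
  · rw [hs.tsum_eq_zero_add, h0, ← tsum_mul_left]
    simp only [mul_zero, zero_add]
    refine tsum_congr fun j => ?_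
    ring

lemma BS_succ {b : ℕ → ℂ} (hb : BS b) (h0 : b 0 = 0) : BS (fun j => b (j + 1)) := by
  intro z hz
  obtain ⟨h1, h2⟩ := BS_succ_sum hb h0 hz
  refine ⟨h1, ?_⟩
  have hmaps : Set.MapsTo (fun z => ∑' j, z ^ j * b j) (Metric.ball 0 1)
      (Metric.closedBall 0 1) := by
    intro w hw
    simpa using (hb w (by simpa using hw)).2
  by_cases hz0 : z = 0
  · subst hz0
    rw [tsum_zero_pow (fun j => b (j + 1)), ← (BS_deriv hb).deriv]
    refine Complex.norm_deriv_le_one_of_mapsTo_ball (BS_diff hb) ?_ one_pos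
    simpa only [tsum_zero_pow, h0] using hmaps
  · have h3 := Complex.norm_le_norm_of_mapsTo_ball (BS_diff hb) hmaps
      (by simpa only [tsum_zero_pow] using h0) hz
    simp only [h2, norm_mul] at h3
    have : 0 < ‖z‖ := norm_pos_iff.mpr hz0
    exact le_of_mul_le_mul_left (by simpa using h3) this

lemma BS_schwarz (k : ℕ) : ∀ {b : ℕ → ℂ}, BS b → (∀ j, j < k → b j = 0) → ∀ {z : ℂ}, ‖z‖ < 1 →
    ‖∑' j, z ^ j * b j‖ ≤ ‖z‖ ^ k := by
  induction k with
  | zero => intro b hb _ z hz; simpa using (hb z hz).2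
  | succ k ih =>
    intro b hb h0 z hz
    have h00 := h0 0 (Nat.succ_pos k)
    rw [(BS_succ_sum hb h00 hz).2, norm_mul, pow_succ']
    exact mul_le_mul_of_nonneg_left
      (ih (BS_succ hb h00) (fun j hj => h0 (j + 1) (by omega)) hz) (norm_nonneg _)

lemma BS_pick {b : ℕ → ℂ} (hb : BS b) (h0 : ‖b 0‖ < 1) : ‖b 1‖ ≤ 1 - ‖b 0‖ ^ 2 := by
  set a := b 0 with ha
  set F : ℂ → ℂ := fun z => ∑' j, z ^ j * b j with hF
  have hF0 : F 0 = a := tsum_zero_pow b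
  have hden : ∀ w : ℂ, ‖w‖ ≤ 1 → 1 - star a * w ≠ 0 := by
    intro w hw h
    have : star a * w = 1 := (sub_eq_zero.mp h).symm
    have h2 : ‖a‖ * ‖w‖ = 1 := by
      rw [← norm_star a, ← norm_mul, this, norm_one]
    nlinarith [norm_nonneg a, norm_nonneg w]
  have hFle : ∀ z ∈ Metric.ball (0 : ℂ) 1, ‖F z‖ ≤ 1 := fun z hz => (hb z (by simpa using hz)).2
  set G : ℂ → ℂ := fun z => (F z - a) / (1 - star a * F z) with hG
  have hGd : DifferentiableOn ℂ G (Metric.ball 0 1) := by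
    refine DifferentiableOn.div ((BS_diff hb).sub_const a) ?_ fun z hz => hden _ (hFle z hz)
    exact (differentiableOn_const 1).sub ((BS_diff hb).const_mul _)
  have hGle : ∀ z ∈ Metric.ball (0 : ℂ) 1, ‖G z‖ ≤ 1 := by
    intro z hz
    have h1 := hFle z hz
    simp only [hG, norm_div]
    rw [div_le_one (norm_pos_iff.mpr (hden _ h1)), ← sq_le_sq₀ (norm_nonneg _) (norm_nonneg _)]
    have h2 : ‖F z‖ ^ 2 ≤ 1 := by nlinarith [norm_nonneg (F z)]
    have h3 : ‖a‖ ^ 2 ≤ 1 := by nlinarith [norm_nonneg a]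
    rw [Complex.sq_norm, Complex.normSq_apply] at h2 h3 ⊢
    rw [Complex.sq_norm, Complex.normSq_apply]
    simp
    nlinarith [mul_nonneg (sub_nonneg.2 h2) (sub_nonneg.2 h3)]
  have hG0 : G 0 = 0 := by simp [hG, hF0]
  have hsq : star a * a = ((‖a‖ ^ 2 : ℝ) : ℂ) := by
    rw [Complex.sq_norm, Complex.normSq_eq_conj_mul_self]; rfl
  have hder : HasDerivAt G (b 1 / (1 - star a * a)) 0 := by
    have hf := BS_deriv hb
    have h1 := (hf.sub_const a).div ((hf.const_mul (star a)).const_sub 1)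
      (hden _ (hFle 0 (by simp)))
    refine h1.congr_deriv ?_
    rw [tsum_zero_pow b, ← ha, sub_self, zero_mul, sub_zero]
    have := hden a h0.le
    field_simp
  have hle := Complex.norm_deriv_le_one_of_mapsTo_ball hGd
    (fun z hz => by simpa [hG0] using hGle z hz) one_pos
  rw [hder.deriv, hsq, norm_div] at hle
  have hpos : 0 < 1 - ‖a‖ ^ 2 := by nlinarith [norm_nonneg a]
  have hn : ‖(1 - ((‖a‖ ^ 2 : ℝ) : ℂ))‖ = 1 - ‖a‖ ^ 2 := by
    rw [← Complex.ofReal_one, ← Complex.ofReal_sub, Complex.norm_real, Real.norm_of_nonneg hpos.le]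
  rwa [hn, div_le_one hpos] at hle

lemma BS_avg {b : ℕ → ℂ} (hb : BS b) {k : ℕ} (hk : 0 < k) : BS (fun n => b (k * n)) := by
  intro z hz
  obtain ⟨w, hw⟩ := IsAlgClosed.exists_pow_nat_eq z hk
  have hw1 : ‖w‖ < 1 := by
    by_contra h
    push Not at h
    have := one_le_pow₀ h (n := k)
    rw [← norm_pow, hw] at this
    linarith
  set ζ := Complex.exp (2 * Real.pi * Complex.I / k) with hζd
  have hζ : IsPrimitiveRoot ζ k := Complex.isPrimitiveRoot_exp k hk.ne'
  have hζn : ‖ζ‖ = 1 := hζ.norm'_eq_one hk.ne'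
  have hl : ∀ l : ℕ, ‖ζ ^ l * w‖ < 1 := fun l => by simpa [hζn] using hw1
  have hsum : HasSum (fun j => ∑ l ∈ Finset.range k, (ζ ^ l * w) ^ j * b j)
      (∑ l ∈ Finset.range k, ∑' j, (ζ ^ l * w) ^ j * b j) :=
    hasSum_sum fun l _ => (hb _ (hl l)).1.hasSum
  have hterm : ∀ j, ∑ l ∈ Finset.range k, (ζ ^ l * w) ^ j * b j =
      if k ∣ j then (k : ℂ) * (w ^ j * b j) else 0 := by
    intro j
    have h1 : ∀ l, (ζ ^ l * w) ^ j * b j = (ζ ^ j) ^ l * (w ^ j * b j) := by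
      intro l; rw [mul_pow, ← pow_mul, ← pow_mul, mul_comm l j]; ring
    simp only [h1]
    rw [← Finset.sum_mul]
    split_ifs with h
    · rw [(hζ.pow_eq_one_iff_dvd j).2 h]; simp
    · have hne : ζ ^ j ≠ 1 := fun h' => h ((hζ.pow_eq_one_iff_dvd j).1 h')
      rw [geom_sum_eq hne, ← pow_mul, mul_comm j k, pow_mul, hζ.pow_eq_one]
      simp
  have hinj : Function.Injective (fun n : ℕ => k * n) := fun x y h => Nat.eq_of_mul_eq_mul_left hk h
  simp only [hterm] at hsum
  rw [← hinj.hasSum_iff] at hsum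
  swap
  · intro j hj
    rw [if_neg]
    rintro ⟨n, rfl⟩
    exact hj ⟨n, rfl⟩
  have hk0 : (k : ℂ) ≠ 0 := by exact_mod_cast hk.ne'
  have hs2 := hsum.mul_left (k : ℂ)⁻¹
  have hfun : (fun n => (k : ℂ)⁻¹ * ((fun j => if k ∣ j then (k : ℂ) * (w ^ j * b j) else 0) ∘
      fun n => k * n) n) = fun n => z ^ n * b (k * n) := by
    funext n
    simp only [Function.comp, dvd_mul_right, if_true]
    rw [pow_mul, hw]
    field_simp
  rw [hfun] at hs2
  refine ⟨hs2.summable, ?_⟩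
  rw [hs2.tsum_eq, norm_mul, norm_inv, Complex.norm_natCast]
  have : ‖∑ l ∈ Finset.range k, ∑' j, (ζ ^ l * w) ^ j * b j‖ ≤ k := by
    refine (norm_sum_le _ _).trans ?_
    refine (Finset.sum_le_sum fun l _ => (hb _ (hl l)).2).trans ?_
    simp
  have hkr : (0 : ℝ) < k := by exact_mod_cast hk
  rw [inv_mul_le_iff₀ hkr]
  simpa using this

lemma BS_coeff {b : ℕ → ℂ} (hb : BS b) (h0 : ‖b 0‖ < 1) {k : ℕ} (hk : 0 < k) :
    ‖b k‖ ≤ 1 - ‖b 0‖ ^ 2 := by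
  simpa using BS_pick (BS_avg hb hk) (by simpa using h0)

lemma SB_zero {p : ℕ → ℍ[ℝ]} (hp : SBClass p) : ‖p 0‖ < 1 := by
  have h := hp.2 0 (by simp)
  have h2 : sliceVal p 0 = p 0 := by
    unfold sliceVal
    rw [tsum_eq_single 0]
    · simp
    · intro j hj
      simp [hj]
  rwa [h2] at h

lemma SB_coeff {p : ℕ → ℍ[ℝ]} (hp : SBClass p) {k : ℕ} (hk : 0 < k) :
    ‖p k‖ ≤ 1 - ‖p 0‖ ^ 2 := by
  obtain ⟨u, hu, hu0⟩ := exists_rot (p 0)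
  obtain ⟨I, hI, z, hz⟩ := exists_slice (p k * u)
  have hb := slice_BS hp hI hu
  have h0 : ‖ppi I (p 0 * u)‖ = ‖p 0‖ := by
    rw [hu0, ppi_real, Complex.norm_real, norm_norm]
  have hkn : ‖ppi I (p k * u)‖ = ‖p k‖ := by
    rw [← hz, ppi_phi hI, ← norm_phi hI, hz, norm_mul, hu, mul_one]
  have := BS_coeff hb (by rw [h0]; exact SB_zero hp) hk
  simpa only [h0, hkn] using this

lemma SB_schwarz {k : ℕ} {p : ℕ → ℍ[ℝ]} (hp : SBnClass k p) {q : ℍ[ℝ]} (hq : ‖q‖ < 1) :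
    ‖sliceVal p q‖ ≤ ‖q‖ ^ k := by
  obtain ⟨u, hu, hu0⟩ := exists_rot (sliceVal p q)
  obtain ⟨I, hI, z, rfl⟩ := exists_slice q
  rw [norm_phi hI] at hq ⊢
  have hb := slice_BS hp.1 hI hu
  have h := BS_schwarz k hb (fun j hj => by simp [hp.2.1 j hj]) hq
  rw [(slice_hasSum hp.1 hI u hq).tsum_eq, hu0, ppi_real, Complex.norm_real, norm_norm] at h
  exact h

lemma g_max {k : ℕ} (hk : 2 ≤ k) {x : ℝ} (h0 : 0 ≤ x) (h1 : x ≤ 1) :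
    (1 + x) ^ k * (1 - x) ^ (k - 1) ≤
      (1 + 1 / (2 * (k : ℝ) - 1)) ^ k * (1 - 1 / (2 * (k : ℝ) - 1)) ^ (k - 1) := by
  have hk2 : (2 : ℝ) ≤ k := by exact_mod_cast hk
  obtain ⟨n, rfl⟩ : ∃ n, k = n + 1 := ⟨k - 1, by omega⟩
  simp only [Nat.add_sub_cancel]
  push_cast at hk2 ⊢
  have hn : (1 : ℝ) ≤ n := by linarith
  set A : ℝ := 1 + 1 / (2 * ((n : ℝ) + 1) - 1) with hA
  set B : ℝ := 1 - 1 / (2 * ((n : ℝ) + 1) - 1) with hB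
  have hden : (0 : ℝ) < 2 * ((n : ℝ) + 1) - 1 := by linarith
  have hA' : A = 2 * (n + 1) / (2 * ((n : ℝ) + 1) - 1) := by rw [hA]; field_simp; ring
  have hB' : B = 2 * n / (2 * ((n : ℝ) + 1) - 1) := by rw [hB]; field_simp; ring
  have hApos : 0 < A := by rw [hA']; positivity
  have hBpos : 0 < B := by rw [hB']; positivity
  have hu : (1 + x) / A ≤ Real.exp ((1 + x) / A - 1) := by
    linarith [Real.add_one_le_exp ((1 + x) / A - 1)]
  have hv : (1 - x) / B ≤ Real.exp ((1 - x) / B - 1) := by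
    linarith [Real.add_one_le_exp ((1 - x) / B - 1)]
  have h1' : ((1 + x) / A) ^ (n + 1) * ((1 - x) / B) ^ n ≤ 1 := by
    calc ((1 + x) / A) ^ (n + 1) * ((1 - x) / B) ^ n
        ≤ Real.exp ((1 + x) / A - 1) ^ (n + 1) * Real.exp ((1 - x) / B - 1) ^ n := by
          have : 0 ≤ (1 - x) / B := div_nonneg (by linarith) hBpos.le
          gcongr
      _ = 1 := by
          rw [← Real.exp_nat_mul, ← Real.exp_nat_mul, ← Real.exp_add, Real.exp_eq_one_iff, hA', hB']
          push_cast
          field_simp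
          ring
  rw [div_pow, div_pow, div_mul_div_comm, div_le_one (by positivity)] at h1'
  exact h1'

lemma g_eq {k : ℕ} (hk : 1 ≤ k) (x : ℝ) :
    (1 + x) ^ 2 * (1 - x ^ 2) ^ (2 * k - 2) = ((1 + x) ^ k * (1 - x) ^ (k - 1)) ^ 2 := by
  obtain ⟨n, rfl⟩ : ∃ n, k = n + 1 := ⟨k - 1, by omega⟩
  have : 2 * (n + 1) - 2 = 2 * n := by omega
  rw [this, Nat.add_sub_cancel, show 1 - x ^ 2 = (1 + x) * (1 - x) by ring]
  rw [mul_pow, mul_pow]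
  ring

lemma cmax_bound {k : ℕ} (hk : 2 ≤ k) {x : ℝ} (h0 : 0 ≤ x) (h1 : x ≤ 1) :
    (1 + x) ^ 2 * (1 - x ^ 2) ^ (2 * k - 2) ≤ (2 * (k : ℝ) - 1) * cmax k := by
  have hk2 : (2 : ℝ) ≤ k := by exact_mod_cast hk
  have hden : (0 : ℝ) < 2 * (k : ℝ) - 1 := by linarith
  set x0 : ℝ := 1 / (2 * (k : ℝ) - 1) with hx0
  have hx00 : 0 ≤ x0 := by positivity
  have hx01 : x0 ≤ 1 := by rw [hx0, div_le_one hden]; linarith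
  have hle : x0 * (1 + x0) ^ 2 * (1 - x0 ^ 2) ^ (2 * k - 2) ≤ cmax k := by
    refine le_csSup ?_ ⟨x0, ⟨hx00, hx01⟩, rfl⟩
    refine (isCompact_Icc.image ?_).bddAbove
    fun_prop
  have h2 : (1 + x) ^ 2 * (1 - x ^ 2) ^ (2 * k - 2) ≤
      (1 + x0) ^ 2 * (1 - x0 ^ 2) ^ (2 * k - 2) := by
    rw [g_eq (by omega), g_eq (by omega)]
    have := g_max hk h0 h1
    have hnn : 0 ≤ (1 + x) ^ k * (1 - x) ^ (k - 1) :=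
      mul_nonneg (pow_nonneg (by linarith) _) (pow_nonneg (by linarith) _)
    exact pow_le_pow_left₀ hnn this 2
  calc _ ≤ _ := h2
    _ = (2 * (k : ℝ) - 1) * (x0 * (1 + x0) ^ 2 * (1 - x0 ^ 2) ^ (2 * k - 2)) := by
      have : (2 * (k : ℝ) - 1) * x0 = 1 := by rw [hx0]; field_simp
      rw [← mul_assoc, ← mul_assoc, this, one_mul]
    _ ≤ _ := mul_le_mul_of_nonneg_left hle hden.le

lemma term_bound {k : ℕ} (hk : 2 ≤ k) {x : ℝ} (h0 : 0 ≤ x) (h1 : x ≤ 1) :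
    (1 - x ^ 2) ^ (2 * k) ≤ (2 * (2 * (k : ℝ) - 1) * cmax k) * ((1 - x) ^ 2 / 2) := by
  have h := mul_le_mul_of_nonneg_right (cmax_bound hk h0 h1) (sq_nonneg (1 - x))
  obtain ⟨n, hn⟩ : ∃ n, 2 * k = n + 2 := ⟨2 * k - 2, by omega⟩
  rw [hn, pow_add]
  rw [hn, Nat.add_sub_cancel] at h
  nlinarith [h]

theorem bohr_improved (m : ℝ) (hm0 : 0 < m) (hm1 : m ≤ 1)
    (p : ℕ → ℍ[ℝ]) (hp : SBClass p)
    (w : ℕ → ℕ → ℍ[ℝ]) (hw : ∀ k, 1 ≤ k → SBnClass k (w k))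
    (N : ℕ) (hN : 1 ≤ N) (d : ℕ → ℝ) (hd : ∀ i, 1 ≤ i → i ≤ N → 0 ≤ d i)
    (hL : 8 * d 1 * Mconst m ^ 2 +
        ∑ k ∈ Finset.Icc 2 N, 2 * (2 * (k : ℝ) - 1) * cmax k * d k * Mconst m ^ (2 * k) ≤ m)
    (q : ℍ[ℝ]) (hq : ‖q‖ < 1) (hqr : ‖q‖ ≤ m / (2 + m)) :
    ‖p 0‖ ^ m + (∑' k : ℕ, ‖sliceVal (w (k + 1)) q‖ * ‖p (k + 1)‖) +
      ∑ i ∈ Finset.Icc 1 N, d i * Sstar p q ^ i ≤ 1 := by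
  set a := ‖p 0‖ with ha
  set r := ‖q‖ with hr
  have ha0 : 0 ≤ a := norm_nonneg _
  have ha1 : a < 1 := SB_zero hp
  have hr0 : 0 ≤ r := norm_nonneg _
  have hA : 0 ≤ 1 - a ^ 2 := by nlinarith
  have hr2 : r * (2 + m) ≤ m := by rwa [le_div_iff₀ (by linarith)] at hqr
  -- first sum
  have hgeo : HasSum (fun k : ℕ => r ^ (k + 1) * (1 - a ^ 2)) (r * (1 - r)⁻¹ * (1 - a ^ 2)) := by
    have := ((hasSum_geometric_of_lt_one hr0 hq).mul_left r).mul_right (1 - a ^ 2)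
    simpa only [pow_succ'] using this
  have hle1 : ∀ k : ℕ, ‖sliceVal (w (k + 1)) q‖ * ‖p (k + 1)‖ ≤ r ^ (k + 1) * (1 - a ^ 2) :=
    fun k => mul_le_mul (SB_schwarz (hw (k + 1) (by omega)) hq) (SB_coeff hp (by omega))
      (norm_nonneg _) (by positivity)
  have hsum1 : Summable (fun k : ℕ => ‖sliceVal (w (k + 1)) q‖ * ‖p (k + 1)‖) :=
    Summable.of_nonneg_of_le (fun k => by positivity) hle1 hgeo.summable
  have hT1 : (∑' k : ℕ, ‖sliceVal (w (k + 1)) q‖ * ‖p (k + 1)‖) ≤ m / 2 * (1 - a ^ 2) := by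
    refine (hsum1.tsum_le_tsum hle1 hgeo.summable).trans ?_
    rw [hgeo.tsum_eq]
    refine mul_le_mul_of_nonneg_right ?_ hA
    rw [← div_eq_mul_inv, div_le_iff₀ (by linarith)]
    nlinarith
  -- S*
  have hr2lt : ‖r ^ 2‖ < 1 := by
    rw [Real.norm_of_nonneg (by positivity)]; nlinarith
  have hMnn : 0 ≤ Mconst m := by unfold Mconst; positivity
  have hrM : r / (1 - r ^ 2) ≤ Mconst m := by
    unfold Mconst
    rw [div_le_div_iff₀ (by nlinarith) (by linarith)]
    have h1 : 0 ≤ m - r * (2 + m) := by linarith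
    nlinarith [mul_nonneg h1 (show 0 ≤ 2 + m + m * r by positivity)]
  have hS0 : 0 ≤ Sstar p q := tsum_nonneg fun k => by positivity
  have hgeo2 : HasSum (fun k : ℕ => ((k : ℝ) + 1) * r ^ (2 * (k + 1)) * (1 - a ^ 2) ^ 2)
      ((r / (1 - r ^ 2)) ^ 2 * (1 - a ^ 2) ^ 2) := by
    have h1 := hasSum_coe_mul_geometric_of_norm_lt_one hr2lt
    rw [← hasSum_nat_add_iff' 1] at h1
    have h2 := h1.mul_right ((1 - a ^ 2) ^ 2)
    simp only [Finset.range_one, Finset.sum_singleton, Nat.cast_zero, zero_mul, sub_zero] at h2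
    rw [div_pow]
    simpa only [pow_mul, Nat.cast_add, Nat.cast_one] using h2
  have hle2 : ∀ k : ℕ, ((k : ℝ) + 1) * r ^ (2 * (k + 1)) * ‖p (k + 1)‖ ^ 2 ≤
      ((k : ℝ) + 1) * r ^ (2 * (k + 1)) * (1 - a ^ 2) ^ 2 := by
    intro k
    have := SB_coeff hp (k := k + 1) (by omega)
    gcongr
  have hS : Sstar p q ≤ (Mconst m * (1 - a ^ 2)) ^ 2 := by
    have hs : Summable fun k : ℕ => ((k : ℝ) + 1) * r ^ (2 * (k + 1)) * ‖p (k + 1)‖ ^ 2 :=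
      Summable.of_nonneg_of_le (fun k => by positivity) hle2 hgeo2.summable
    refine (hs.tsum_le_tsum hle2 hgeo2.summable).trans ?_
    rw [hgeo2.tsum_eq, mul_pow]
    have : 0 ≤ r / (1 - r ^ 2) := div_nonneg hr0 (by nlinarith)
    gcongr
  have hSi : ∀ i, Sstar p q ^ i ≤ Mconst m ^ (2 * i) * (1 - a ^ 2) ^ (2 * i) := by
    intro i
    rw [← mul_pow, pow_mul]
    exact pow_le_pow_left₀ hS0 hS i
  -- Bernoulli
  have hbern : a ^ m ≤ 1 + m * (a - 1) := by
    have := rpow_one_add_le_one_add_mul_self (s := a - 1) (by linarith) hm0.le hm1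
    simpa using this
  have hsplit : Finset.Icc 1 N = insert 1 (Finset.Icc 2 N) := by
    ext i; simp only [Finset.mem_Icc, Finset.mem_insert]; omega
  have hT2 : ∑ i ∈ Finset.Icc 1 N, d i * Sstar p q ^ i ≤ m * ((1 - a) ^ 2 / 2) := by
    rw [hsplit, Finset.sum_insert (by simp)]
    refine le_trans ?_ (mul_le_mul_of_nonneg_right hL (by positivity))
    rw [add_mul, Finset.sum_mul]
    refine add_le_add ?_ (Finset.sum_le_sum ?_)
    · have h1 := hSi 1
      have hd1 := hd 1 le_rfl hN
      refine (mul_le_mul_of_nonneg_left h1 hd1).trans ?_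
      have h3 : (1 - a ^ 2) ^ 2 ≤ 8 * ((1 - a) ^ 2 / 2) := by
        have : (1 - a ^ 2) ^ 2 = (1 - a) ^ 2 * (1 + a) ^ 2 := by ring
        rw [this]
        have : (1 + a) ^ 2 ≤ 4 := by nlinarith
        nlinarith [sq_nonneg (1 - a)]
      have := mul_le_mul_of_nonneg_left h3 (mul_nonneg hd1 (sq_nonneg (Mconst m)))
      simp only [mul_one]
      linarith
    · intro i hi
      rw [Finset.mem_Icc] at hi
      have hdi := hd i (by omega) hi.2
      refine (mul_le_mul_of_nonneg_left (hSi i) hdi).trans ?_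
      have := mul_le_mul_of_nonneg_left (term_bound hi.1 ha0 ha1.le)
        (mul_nonneg hdi (pow_nonneg hMnn (2 * i)))
      linarith
  nlinarith
end
end

section
/- Let f(q) = ∑_{k=0}^∞ qᵏ pₖ be a slice regular function on the open unit ball 𝔹 of the quaternions such that Re(f(q)) ≤ 1 for all q ∈ 𝔹 and such that p₀ is real with p₀ ∈ [0,1). Then ∑_{k=0}^∞ |q|ᵏ |pₖ| + (1/(1+p₀) + |q|/(1−|q|)) · ∑_{k=1}^∞ |q|^{2k} |pₖ|² ≤ 1 for every q ∈ 𝔹 with |q| ≤ R_*, where R_* is the unique root in (0,1) of the equation 3r³ − 5r² − 3r + 1 = 0 (R_* ≈ 0.24683). -/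
noncomputable section
open scoped Quaternion

open Complex in
lemma aux_int (m : ℤ) : ∫ t in (0:ℝ)..(2 * Real.pi), cexp ((m : ℂ) * I * t) =
    if m = 0 then (2 * Real.pi : ℂ) else 0 := by
  split_ifs with h
  · subst h; simp
  · have hc : (m : ℂ) * I ≠ 0 := mul_ne_zero (by exact_mod_cast h) I_ne_zero
    rw [integral_exp_mul_complex hc]
    have : cexp ((m : ℂ) * I * ((2 * Real.pi : ℝ) : ℂ)) = 1 := by
      rw [Complex.exp_eq_one_iff]
      exact ⟨m, by push_cast; ring⟩
    rw [this]; simp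

open Complex in
lemma aux_norm (m : ℤ) (t : ℝ) : ‖cexp ((m : ℂ) * I * t)‖ = 1 := by
  have : (m : ℂ) * I * t = ((m * t : ℝ) : ℂ) * I := by push_cast; ring
  rw [this, Complex.norm_exp_ofReal_mul_I]

open Complex in
lemma aux_coef (c : ℕ → ℂ) (hc : Summable fun n => ‖c n‖) (m : ℤ) :
    ∫ t in (0:ℝ)..(2 * Real.pi),
      (∑' n : ℕ, c n * cexp (((n : ℤ) : ℂ) * I * t)) * cexp ((m : ℂ) * I * t) =
    ∑' n : ℕ, c n * (if (n : ℤ) + m = 0 then (2 * Real.pi : ℂ) else 0) := by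
  symm
  apply HasSum.tsum_eq
  have key := intervalIntegral.hasSum_integral_of_dominated_convergence
    (μ := MeasureTheory.volume) (a := 0) (b := 2 * Real.pi)
    (F := fun (n : ℕ) (t : ℝ) => c n * cexp ((((n : ℤ) + m : ℤ) : ℂ) * I * t))
    (f := fun t : ℝ => (∑' n : ℕ, c n * cexp (((n : ℤ) : ℂ) * I * t)) * cexp ((m : ℂ) * I * t))
    (fun n _ => ‖c n‖)
    (fun n => (by fun_prop : Continuous fun t : ℝ =>
      c n * cexp ((((n : ℤ) + m : ℤ) : ℂ) * I * t)).aestronglyMeasurable)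
    (fun n => Filter.Eventually.of_forall fun t _ => by
      rw [norm_mul, aux_norm, mul_one])
    (Filter.Eventually.of_forall fun t _ => hc)
    (by simp)
    (Filter.Eventually.of_forall fun t _ => by
      have hs : Summable fun n : ℕ => c n * cexp (((n : ℤ) : ℂ) * I * t) := by
        refine Summable.of_norm ?_
        simpa only [norm_mul, aux_norm, mul_one] using hc
      refine (hs.hasSum.mul_right (cexp ((m : ℂ) * I * t))).congr_fun ?_ 
      intro n
      rw [mul_assoc (c n), ← Complex.exp_add]
      congr 2
      push_cast; ring)
  refine key.congr_fun ?_
  intro n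
  rw [intervalIntegral.integral_const_mul, aux_int]

open Complex in
lemma aux_carath (c : ℕ → ℂ) (hc : Summable fun n => ‖c n‖)
    (h : ∀ t : ℝ, (∑' n : ℕ, c n * cexp (((n : ℤ) : ℂ) * I * t)).re ≤ 1) (k : ℕ) (hk : k ≠ 0) :
    ‖c k‖ ≤ 2 * (1 - (c 0).re) := by
  set F : ℝ → ℂ := fun t => ∑' n : ℕ, c n * cexp (((n : ℤ) : ℂ) * I * t) with hF
  have hpi := Real.pi_pos
  have hFc : Continuous F := by
    refine continuous_tsum (fun n => by fun_prop) hc (fun n t => ?_)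
    rw [norm_mul, aux_norm, mul_one]
  have h0 : ∫ t in (0:ℝ)..(2 * Real.pi), F t = 2 * Real.pi * c 0 := by
    have := aux_coef c hc 0
    rw [tsum_eq_single 0 (by intro n hn; simp [hn])] at this
    simp only [Int.cast_zero, zero_mul, Complex.exp_zero, mul_one] at this
    rw [hF]; rw [this]; simp; ring
  have h1 : ∫ t in (0:ℝ)..(2 * Real.pi), F t * cexp (((-k : ℤ) : ℂ) * I * t)
      = 2 * Real.pi * c k := by
    have := aux_coef c hc (-k)
    rw [tsum_eq_single k (by
      intro n hn
      rw [if_neg (by omega), mul_zero])] at this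
    rw [hF]; rw [this]; simp; ring
  have h2 : ∫ t in (0:ℝ)..(2 * Real.pi), F t * cexp (((k : ℤ) : ℂ) * I * t) = 0 := by
    have := aux_coef c hc k
    rw [hF]; rw [this]
    convert tsum_zero with n
    rw [if_neg (by omega), mul_zero]
  have h2' : ∫ t in (0:ℝ)..(2 * Real.pi),
      (starRingEnd ℂ) (F t) * cexp (((-k : ℤ) : ℂ) * I * t) = 0 := by
    have e : ∀ t : ℝ, (starRingEnd ℂ) (F t) * cexp (((-k : ℤ) : ℂ) * I * t) =
        (starRingEnd ℂ) (F t * cexp (((k : ℤ) : ℂ) * I * t)) := by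
      intro t
      rw [map_mul, ← Complex.exp_conj]
      simp
    simp_rw [e]
    rw [intervalIntegral.integral_of_le (by positivity)] at h2 ⊢
    rw [integral_conj, h2, map_zero]
  have h3 : ∫ t in (0:ℝ)..(2 * Real.pi), cexp (((-k : ℤ) : ℂ) * I * t) = 0 := by
    rw [aux_int, if_neg (by omega)]
  have h4 : ∫ t in (0:ℝ)..(2 * Real.pi), (((F t).re - 1 : ℝ) : ℂ) * cexp (((-k : ℤ) : ℂ) * I * t)
      = Real.pi * c k := by
    have e : ∀ t : ℝ, (((F t).re - 1 : ℝ) : ℂ) * cexp (((-k : ℤ) : ℂ) * I * t) =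
       (1/2 : ℂ) * (F t * cexp (((-k : ℤ) : ℂ) * I * t)) +
       (1/2 : ℂ) * ((starRingEnd ℂ) (F t) * cexp (((-k : ℤ) : ℂ) * I * t)) -
        cexp (((-k : ℤ) : ℂ) * I * t) := by
      intro t
      have : (((F t).re : ℝ) : ℂ) = (F t + (starRingEnd ℂ) (F t)) / 2 := by
        rw [Complex.add_conj]; push_cast; ring
      rw [Complex.ofReal_sub, this]
      push_cast; ring
    have hcc : Continuous fun t => (starRingEnd ℂ) (F t) := Complex.continuous_conj.comp hFc
    simp_rw [e]
    rw [intervalIntegral.integral_sub, intervalIntegral.integral_add,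
      intervalIntegral.integral_const_mul, intervalIntegral.integral_const_mul, h1, h2', h3]
    · ring
    all_goals exact Continuous.intervalIntegrable (by fun_prop) _ _
  have h5 : ∫ t in (0:ℝ)..(2 * Real.pi), (1 - (F t).re) = 2 * Real.pi * (1 - (c 0).re) := by
    have hre : ∫ t in (0:ℝ)..(2 * Real.pi), (F t).re = 2 * Real.pi * (c 0).re := by
      have := Complex.reCLM.intervalIntegral_comp_comm
        (hFc.intervalIntegrable (μ := MeasureTheory.volume) 0 (2 * Real.pi))
      simp only [Complex.reCLM_apply] at this
      rw [this, h0]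
      simp
    rw [intervalIntegral.integral_sub, hre]
    · simp; ring
    all_goals exact Continuous.intervalIntegrable (by fun_prop) _ _
  have h6 : ‖(Real.pi : ℂ) * c k‖ ≤ 2 * Real.pi * (1 - (c 0).re) := by
    rw [← h4, ← h5]
    refine (intervalIntegral.norm_integral_le_integral_norm (by positivity)).trans (le_of_eq ?_)
    refine intervalIntegral.integral_congr fun t _ => ?_
    rw [norm_mul, aux_norm, mul_one, Complex.norm_real, Real.norm_eq_abs,
      abs_of_nonpos (by linarith [h t])]
    ring
  rw [norm_mul, Complex.norm_real, Real.norm_of_nonneg hpi.le] at h6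
  have : Real.pi * ‖c k‖ ≤ Real.pi * (2 * (1 - (c 0).re)) := by linarith
  exact le_of_mul_le_mul_left this hpi

lemma aux_unit (w : ℍ[ℝ]) : ∃ (J : ℍ[ℝ]) (x y : ℝ), J.re = 0 ∧ J * J = -1 ∧
    w = (x : ℍ[ℝ]) + (y : ℍ[ℝ]) * J := by
  by_cases hw : w.im = 0
  · obtain ⟨J, j0, j1, j2, j3⟩ : ∃ J : ℍ[ℝ], J.re = 0 ∧ J.imI = 1 ∧ J.imJ = 0 ∧ J.imK = 0 :=
      ⟨⟨0, 1, 0, 0⟩, rfl, rfl, rfl, rfl⟩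
    refine ⟨J, w.re, 0, j0, ?_, ?_⟩
    · ext <;> simp [j0, j1, j2, j3]
    · have := Quaternion.re_add_im w
      rw [hw] at this
      simpa using this.symm
  · have hn : ‖w.im‖ ≠ 0 := norm_ne_zero_iff.mpr hw
    refine ⟨((‖w.im‖⁻¹ : ℝ) : ℍ[ℝ]) * w.im, w.re, ‖w.im‖, ?_, ?_, ?_⟩
    · rw [Quaternion.coe_mul_eq_smul, Quaternion.re_smul]; simp
    · have e : w.im * w.im = -((‖w.im‖ * ‖w.im‖ : ℝ) : ℍ[ℝ]) := by
        rw [← Quaternion.normSq_eq_norm_mul_self, ← sq, Quaternion.im_sq]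
      rw [mul_assoc, ← mul_assoc w.im, ← Quaternion.coe_commutes, mul_assoc, e, ← mul_assoc,
        mul_neg, ← Quaternion.coe_mul, ← Quaternion.coe_mul]
      congr 1
      rw [← Quaternion.coe_one]
      congr 1
      field_simp
    · rw [← mul_assoc, ← Quaternion.coe_mul, mul_inv_cancel₀ hn]
      simp

lemma aux_pow (J : ℍ[ℝ]) (hJ : J * J = -1) (t : ℝ) (n : ℕ) :
    ((Real.cos t : ℍ[ℝ]) + (Real.sin t : ℍ[ℝ]) * J) ^ n =
      (Real.cos (n * t) : ℍ[ℝ]) + (Real.sin (n * t) : ℍ[ℝ]) * J := by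
  induction n with
  | zero => simp
  | succ n ih =>
    rw [pow_succ, ih]
    have : ((n + 1 : ℕ) : ℝ) * t = n * t + t := by push_cast; ring
    rw [this, Real.cos_add, Real.sin_add]
    generalize Real.cos (n * t) = A
    generalize Real.sin (n * t) = B
    generalize Real.cos t = C
    generalize Real.sin t = D
    have e : ((B : ℍ[ℝ]) * J) * ((D : ℍ[ℝ]) * J) = -((B * D : ℝ) : ℍ[ℝ]) := by
      rw [mul_assoc, ← mul_assoc J, ← Quaternion.coe_commutes, mul_assoc, hJ, ← mul_assoc,
        mul_neg, mul_one, Quaternion.coe_mul]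
    have e2 : ((B : ℍ[ℝ]) * J) * (C : ℍ[ℝ]) = ((B * C : ℝ) : ℍ[ℝ]) * J := by
      rw [mul_assoc, ← Quaternion.coe_commutes, ← mul_assoc, Quaternion.coe_mul]
    rw [add_mul, mul_add, mul_add, e, e2, ← mul_assoc, ← Quaternion.coe_mul, ← Quaternion.coe_mul]
    push_cast
    noncomm_ring

lemma aux_norm_sq (J : ℍ[ℝ]) (hJr : J.re = 0) (hJ : J * J = -1) (x y : ℝ) :
    ‖(x : ℍ[ℝ]) + (y : ℍ[ℝ]) * J‖ ^ 2 = x ^ 2 + y ^ 2 := by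
  have h := congrArg (fun w : ℍ[ℝ] => w.re) hJ
  simp [hJr] at h
  rw [sq, ← Quaternion.normSq_eq_norm_mul_self, Quaternion.normSq_def']
  simp [hJr]
  linear_combination (- y ^ 2) * h

lemma aux_summ (p : ℕ → ℍ[ℝ]) (hreg : SliceRegOn p) (r : ℝ) (hr0 : 0 ≤ r) (hr1 : r < 1) :
    Summable fun n => r ^ n * ‖p n‖ := by
  have := hreg (r : ℍ[ℝ]) (by rw [Quaternion.norm_coe, Real.norm_of_nonneg hr0]; exact hr1)
  have := this.norm
  simpa [norm_mul, norm_pow, abs_of_nonneg hr0] using this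

open Complex in
lemma aux_slice (p : ℕ → ℍ[ℝ]) (hreg : SliceRegOn p)
    (hre : ∀ q : ℍ[ℝ], ‖q‖ < 1 → (sliceVal p q).re ≤ 1) (r : ℝ) (hr0 : 0 ≤ r) (hr1 : r < 1)
    (k : ℕ) (hk : k ≠ 0) : r ^ k * ‖p k‖ ≤ 2 * (1 - (p 0).re) := by
  obtain ⟨J, x, y, hJr, hJ, hpk⟩ := aux_unit (p k)
  set c : ℕ → ℂ := fun n => ((r ^ n : ℝ) : ℂ) * ⟨(p n).re, -(J * p n).re⟩ with hcdef
  have hJn : ‖J‖ = 1 := by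
    have := aux_norm_sq J hJr hJ 0 1
    simp only [Quaternion.coe_zero, Quaternion.coe_one, zero_add, one_mul] at this
    nlinarith [norm_nonneg J]
  have hreabs : ∀ w : ℍ[ℝ], |w.re| ≤ ‖w‖ := by
    intro w
    refine abs_le_of_sq_le_sq ?_ (norm_nonneg _)
    rw [sq ‖w‖, ← Quaternion.normSq_eq_norm_mul_self, Quaternion.normSq_def']
    nlinarith [sq_nonneg w.imI, sq_nonneg w.imJ, sq_nonneg w.imK]
  have hc : Summable fun n => ‖c n‖ := by
    refine Summable.of_nonneg_of_le (fun _ => norm_nonneg _) (fun n => ?_)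
      ((aux_summ p hreg r hr0 hr1).mul_left 2)
    have hrn : 0 ≤ r ^ n := by positivity
    rw [hcdef]; simp only
    rw [norm_mul, Complex.norm_real, Real.norm_of_nonneg hrn]
    have h1 := Complex.norm_le_abs_re_add_abs_im (⟨(p n).re, -(J * p n).re⟩ : ℂ)
    simp only [abs_neg] at h1
    have h2 := hreabs (p n)
    have h3 := hreabs (J * p n)
    rw [norm_mul, hJn, one_mul] at h3
    nlinarith
  have hmain := aux_carath c hc (by
    intro t
    set q : ℍ[ℝ] := (r : ℍ[ℝ]) * ((Real.cos t : ℍ[ℝ]) + (Real.sin t : ℍ[ℝ]) * J) with hq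
    have hqn : ‖q‖ < 1 := by
      have := aux_norm_sq J hJr hJ (Real.cos t) (Real.sin t)
      rw [Real.cos_sq_add_sin_sq] at this
      have h1 : ‖(Real.cos t : ℍ[ℝ]) + (Real.sin t : ℍ[ℝ]) * J‖ = 1 := by
        nlinarith [norm_nonneg ((Real.cos t : ℍ[ℝ]) + (Real.sin t : ℍ[ℝ]) * J)]
      rw [hq, norm_mul, h1, mul_one, Quaternion.norm_coe, Real.norm_of_nonneg hr0]
      exact hr1
    have hs := (hreg q hqn).hasSum.map (QuaternionAlgebra.reₗ (-1:ℝ) 0 (-1)).toAddMonoidHom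
      Quaternion.continuous_re
    have hcs : Summable fun n : ℕ => c n * cexp (((n : ℤ) : ℂ) * I * t) := by
      refine Summable.of_norm ?_
      simpa only [norm_mul, aux_norm, mul_one] using hc
    have hs2 := Complex.hasSum_re hcs.hasSum
    refine le_trans (le_of_eq ?_) (hre q hqn)
    refine HasSum.unique hs2 (hs.congr_fun ?_)
    intro n
    have e1 : cexp (((n : ℤ) : ℂ) * I * t) = ⟨Real.cos (n * t), Real.sin (n * t)⟩ := by
      have : ((n : ℤ) : ℂ) * I * t = ((n * t : ℝ) : ℂ) * I := by push_cast; ring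
      rw [this]
      apply Complex.ext
      · rw [Complex.exp_ofReal_mul_I_re]
      · rw [Complex.exp_ofReal_mul_I_im]
    have e2 : q ^ n * p n = ((r ^ n : ℝ) : ℍ[ℝ]) * ((Real.cos (n * t) : ℍ[ℝ]) * p n +
        (Real.sin (n * t) : ℍ[ℝ]) * (J * p n)) := by
      rw [hq, (Quaternion.coe_commute r _).mul_pow, aux_pow J hJ, Quaternion.coe_pow]
      noncomm_ring
    show (c n * cexp (((n : ℤ) : ℂ) * I * t)).re = (q ^ n * p n).re
    rw [e1, e2, hcdef]
    simp only [Quaternion.coe_mul_eq_smul, Quaternion.re_smul, Quaternion.re_add, mul_assoc,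
      Complex.mul_re, Complex.ofReal_re, Complex.ofReal_im, smul_eq_mul]
    ring) k hk
  have hck : ‖c k‖ = r ^ k * ‖p k‖ := by
    have hrn : 0 ≤ r ^ k := by positivity
    rw [hcdef]; simp only
    rw [norm_mul, Complex.norm_real, Real.norm_of_nonneg hrn]
    congr 1
    have a1 : (p k).re = x := by rw [hpk]; simp [hJr]
    have a2 : (J * p k).re = -y := by
      have : J * p k = (x : ℍ[ℝ]) * J + (y : ℍ[ℝ]) * (J * J) := by
        rw [hpk, mul_add, ← Quaternion.coe_commutes, ← mul_assoc, ← Quaternion.coe_commutes,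
          mul_assoc]
      rw [this, hJ]; simp [hJr]
    rw [a1, a2, neg_neg]
    have b := aux_norm_sq J hJr hJ x y
    rw [← hpk] at b
    have b2 : ‖(⟨x, y⟩ : ℂ)‖ ^ 2 = x ^ 2 + y ^ 2 := by
      rw [← Complex.normSq_eq_norm_sq, Complex.normSq_mk]; ring
    exact (sq_eq_sq₀ (norm_nonneg _) (norm_nonneg _)).mp (b2.trans b.symm)
  have hc0 : (c 0).re = (p 0).re := by simp [hcdef]
  rwa [hck, hc0] at hmain

lemma aux_bound (p : ℕ → ℍ[ℝ]) (hreg : SliceRegOn p)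
    (hre : ∀ q : ℍ[ℝ], ‖q‖ < 1 → (sliceVal p q).re ≤ 1)
    (k : ℕ) (hk : k ≠ 0) : ‖p k‖ ≤ 2 * (1 - (p 0).re) := by
  have hT : Filter.Tendsto (fun r : ℝ => r ^ k * ‖p k‖) (nhdsWithin 1 (Set.Iio 1))
      (nhds (1 ^ k * ‖p k‖)) :=
    ((by fun_prop : Continuous fun r : ℝ => r ^ k * ‖p k‖).tendsto 1).mono_left nhdsWithin_le_nhds
  rw [one_pow, one_mul] at hT
  refine le_of_tendsto hT ?_
  filter_upwards [Ioo_mem_nhdsLT (show (0:ℝ) < 1 by norm_num)] with r hr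
  exact aux_slice p hreg hre r hr.1.le hr.2 k hk

lemma aux_final (a r S T : ℝ) (ha0 : 0 ≤ a) (ha1 : a < 1) (hr0 : 0 ≤ r) (hr1 : r < 1)
    (hr : 0 ≤ 3 * r ^ 3 - 5 * r ^ 2 - 3 * r + 1)
    (hS : S ≤ 2 * (1 - a) * (r / (1 - r))) (hT : T ≤ 4 * (1 - a) ^ 2 * (r ^ 2 / (1 - r ^ 2))) :
    a + S + (1 / (1 + a) + r / (1 - r)) * T ≤ 1 := by
  have h1 : 0 < 1 - r := by linarith
  have h2 : 0 < 1 - r ^ 2 := by nlinarith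
  have h3 : 1 / (1 + a) ≤ 1 := by rw [div_le_one (by linarith)]; linarith
  have h4 : 0 ≤ r / (1 - r) := by positivity
  have h5 : 0 ≤ 1 / (1 + a) := by positivity
  have h6 : 0 ≤ r ^ 2 / (1 - r ^ 2) := by positivity
  have ha : 0 < 1 - a := by linarith
  have key : 2 * (r / (1 - r)) + (1 + r / (1 - r)) * (4 * (r ^ 2 / (1 - r ^ 2))) ≤ 1 := by
    have : 1 - (2 * (r / (1 - r)) + (1 + r / (1 - r)) * (4 * (r ^ 2 / (1 - r ^ 2)))) =
        (3 * r ^ 3 - 5 * r ^ 2 - 3 * r + 1) / ((1 - r) * (1 - r ^ 2)) := by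
      field_simp
      ring
    have h7 : 0 ≤ (3 * r ^ 3 - 5 * r ^ 2 - 3 * r + 1) / ((1 - r) * (1 - r ^ 2)) := by positivity
    linarith
  have s1 : (1 / (1 + a) + r / (1 - r)) * T ≤
      (1 + r / (1 - r)) * (4 * (1 - a) * (r ^ 2 / (1 - r ^ 2))) := by
    calc _ ≤ (1 / (1 + a) + r / (1 - r)) * (4 * (1 - a) ^ 2 * (r ^ 2 / (1 - r ^ 2))) := by gcongr
      _ ≤ (1 + r / (1 - r)) * (4 * (1 - a) * (r ^ 2 / (1 - r ^ 2))) := by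
        gcongr
        nlinarith
  nlinarith [mul_le_mul_of_nonneg_left key ha.le]

theorem bohr_refined_re_le_one (p : ℕ → ℍ[ℝ]) (hreg : SliceRegOn p)
    (hre : ∀ q : ℍ[ℝ], ‖q‖ < 1 → (sliceVal p q).re ≤ 1)
    (a : ℝ) (hp0 : p 0 = (a : ℍ[ℝ])) (ha0 : 0 ≤ a) (ha1 : a < 1)
    (R : ℝ) (hR0 : 0 < R) (hR1 : R < 1) (hroot : 3 * R ^ 3 - 5 * R ^ 2 - 3 * R + 1 = 0)
    (q : ℍ[ℝ]) (hq : ‖q‖ < 1) (hqr : ‖q‖ ≤ R) :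
    (∑' k : ℕ, ‖q‖ ^ k * ‖p k‖) +
      (1 / (1 + a) + ‖q‖ / (1 - ‖q‖)) *
        ∑' k : ℕ, ‖q‖ ^ (2 * (k + 1)) * ‖p (k + 1)‖ ^ 2 ≤ 1 := by 
  have hb : ∀ k : ℕ, ‖p (k + 1)‖ ≤ 2 * (1 - a) := by
    intro k
    have := aux_bound p hreg hre (k + 1) (by omega)
    rwa [hp0, Quaternion.re_coe] at this
  have hr0 : 0 ≤ ‖q‖ := norm_nonneg q
  have hs := aux_summ p hreg ‖q‖ hr0 hq
  generalize ‖q‖ = r at *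
  have hroot' : 0 ≤ 3 * r ^ 3 - 5 * r ^ 2 - 3 * r + 1 := by
    have e : 3 * r ^ 3 - 5 * r ^ 2 - 3 * r + 1 =
      (R - r) * (3 + 5 * (R + r) - 3 * (R ^ 2 + R * r + r ^ 2)) := by linear_combination hroot
    rw [e]
    refine mul_nonneg (by linarith) ?_
    nlinarith [mul_nonneg hR0.le (by linarith : 0 ≤ 1 - R), mul_nonneg hr0 (by linarith : 0 ≤ 1 - r),
      mul_nonneg hR0.le (by linarith : 0 ≤ 1 - r)]
  rw [hs.tsum_eq_zero_add]
  have hz : r ^ 0 * ‖p 0‖ = a := by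
    rw [hp0, Quaternion.norm_coe, Real.norm_of_nonneg ha0]; simp
  rw [hz]
  have hr2 : r ^ 2 < 1 := by nlinarith
  apply aux_final a r _ _ ha0 ha1 hr0 hq hroot'
  · have g := ((hasSum_geometric_of_lt_one hr0 hq).mul_left (2 * (1 - a) * r))
    have e : 2 * (1 - a) * r * (1 - r)⁻¹ = 2 * (1 - a) * (r / (1 - r)) := by ring
    rw [← e, ← g.tsum_eq]
    refine Summable.tsum_le_tsum (fun k => ?_) ((summable_nat_add_iff 1).mpr hs) g.summable
    calc r ^ (k + 1) * ‖p (k + 1)‖ ≤ r ^ (k + 1) * (2 * (1 - a)) := by gcongr; exact hb k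
      _ = _ := by ring
  · have g := ((hasSum_geometric_of_lt_one (sq_nonneg r) hr2).mul_left (4 * (1 - a) ^ 2 * r ^ 2))
    have e : 4 * (1 - a) ^ 2 * r ^ 2 * (1 - r ^ 2)⁻¹ =
      4 * (1 - a) ^ 2 * (r ^ 2 / (1 - r ^ 2)) := by ring
    have hle : ∀ k : ℕ, r ^ (2 * (k + 1)) * ‖p (k + 1)‖ ^ 2 ≤
        4 * (1 - a) ^ 2 * r ^ 2 * (r ^ 2) ^ k := by
      intro k
      calc r ^ (2 * (k + 1)) * ‖p (k + 1)‖ ^ 2 ≤ r ^ (2 * (k + 1)) * (2 * (1 - a)) ^ 2 := by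
            gcongr; exact hb k
        _ = _ := by ring
    rw [← e, ← g.tsum_eq]
    exact Summable.tsum_le_tsum hle
      (Summable.of_nonneg_of_le (fun k => by positivity) hle g.summable) g.summable
end
end

section
/- The constant R_* is best possible in the refined Bohr theorem for functions with real part at most 1: for every r with R_* < r < 1, where R_* is the unique root in (0,1) of 3r³ − 5r² − 3r + 1 = 0, there exist a slice regular function f(q) = ∑_{k=0}^∞ qᵏ pₖ on 𝔹 with Re(f(q)) ≤ 1 for all q ∈ 𝔹 and p₀ real with p₀ ∈ [0,1), and a point q ∈ 𝔹 with |q| = r, such that ∑_{k=0}^∞ |q|ᵏ |pₖ| + (1/(1+p₀) + |q|/(1−|q|)) · ∑_{k=1}^∞ |q|^{2k} |pₖ|² > 1 (for instance f = g_a with p₀ = a and pₖ = −2(1−a) for k ≥ 1, for a ∈ (0,1) close enough to 1). -/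
noncomputable section
open scoped Quaternion

theorem bohr_aux_hasSum (q : ℍ[ℝ]) (hq : ‖q‖ < 1) :
    HasSum (fun k : ℕ => q ^ k * (if k = 0 then (0 : ℍ[ℝ]) else -2)) (2 - (1 - q)⁻¹ * 2) := by
  have h1 : HasSum (fun k : ℕ => q ^ k) (1 - q)⁻¹ := by
    have hs : Summable (fun k : ℕ => q ^ k) := summable_geometric_of_norm_lt_one hq
    have := hs.hasSum
    have hne : (1 - q) ≠ 0 := by
      intro h
      have : q = 1 := (sub_eq_zero.mp h).symm
      simp [this] at hq
    have he : (∑' k : ℕ, q ^ k) * (1 - q) = 1 := geom_series_mul_neg q hq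
    rwa [eq_inv_of_mul_eq_one_left he] at this
  have h2 := (hasSum_ite_eq (0 : ℕ) (2 : ℍ[ℝ])).sub (h1.mul_right 2)
  refine Eq.mp (congrArg (fun g => HasSum g _) (funext fun k => ?_)) h2
  by_cases hk : k = 0 <;> simp [hk]

theorem bohr_aux_re (q : ℍ[ℝ]) (hq : ‖q‖ < 1) : (2 - (1 - q)⁻¹ * 2).re ≤ 1 := by
  have hne : (1 - q) ≠ 0 := by
    intro h
    have : q = 1 := (sub_eq_zero.mp h).symm
    simp [this] at hq
  have hpos : 0 < Quaternion.normSq (1 - q) :=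
    lt_of_le_of_ne Quaternion.normSq_nonneg (Ne.symm (by simpa using hne))
  have hn : Quaternion.normSq q < 1 := by
    rw [Quaternion.normSq_eq_norm_mul_self]
    nlinarith [norm_nonneg q]
  have key : 1 / 2 ≤ ((1 - q)⁻¹).re := by
    rw [Quaternion.instInv]
    simp only [Quaternion.re_smul, Quaternion.re_star, smul_eq_mul]
    rw [inv_mul_eq_div, div_le_div_iff₀ (by norm_num) hpos]
    rw [Quaternion.normSq_def'] at hn ⊢
    simp
    nlinarith
  have e : (2 - (1 - q)⁻¹ * 2).re = 2 - 2 * ((1 - q)⁻¹).re := by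
    rw [mul_two, Quaternion.re_sub, Quaternion.re_add]
    have : (2 : ℍ[ℝ]).re = 2 := rfl
    rw [this]; ring
  rw [e]; linarith

theorem bohr_refined_re_le_one_sharp
    (R : ℝ) (hR0 : 0 < R) (hR1 : R < 1) (hroot : 3 * R ^ 3 - 5 * R ^ 2 - 3 * R + 1 = 0)
    (r : ℝ) (hr1 : R < r) (hr2 : r < 1) :
    ∃ (p : ℕ → ℍ[ℝ]) (a : ℝ) (q : ℍ[ℝ]),
      SliceRegOn p ∧ (∀ q' : ℍ[ℝ], ‖q'‖ < 1 → (sliceVal p q').re ≤ 1) ∧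
      p 0 = (a : ℍ[ℝ]) ∧ 0 ≤ a ∧ a < 1 ∧ ‖q‖ = r ∧
      1 < (∑' k : ℕ, ‖q‖ ^ k * ‖p k‖) +
        (1 / (1 + a) + ‖q‖ / (1 - ‖q‖)) *
          ∑' k : ℕ, ‖q‖ ^ (2 * (k + 1)) * ‖p (k + 1)‖ ^ 2 := by
  have hr0 : 0 < r := hR0.trans hr1
  have hcub : 3 * r ^ 3 - 5 * r ^ 2 - 3 * r + 1 < 0 := by
    have hf : 3 * (r ^ 2 + r * R + R ^ 2) - 5 * (r + R) - 3 < 0 := by nlinarith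
    nlinarith [mul_neg_of_pos_of_neg (sub_pos.mpr hr1) hf]
  have hnr : ‖(r : ℍ[ℝ])‖ = r := by rw [Quaternion.norm_coe, Real.norm_of_nonneg hr0.le]
  have hn2 : ‖(-2 : ℍ[ℝ])‖ = 2 := by
    have : (-2 : ℍ[ℝ]) = ((-2 : ℝ) : ℍ[ℝ]) := by push_cast; rfl
    rw [this, Quaternion.norm_coe]; norm_num
  refine ⟨fun k => if k = 0 then 0 else -2, 0, (r : ℍ[ℝ]),
    fun q hq => (bohr_aux_hasSum q hq).summable, fun q hq => ?_, by simp, le_rfl, one_pos, hnr, ?_⟩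
  · rw [sliceVal, (bohr_aux_hasSum q hq).tsum_eq]
    exact bohr_aux_re q hq
  rw [hnr]
  have hA : HasSum (fun k : ℕ => r ^ k * ‖(if k = 0 then (0 : ℍ[ℝ]) else -2)‖)
      ((1 - r)⁻¹ * 2 - 2) := by
    have h := ((hasSum_geometric_of_lt_one hr0.le hr2).mul_right 2).sub
      (hasSum_ite_eq (0 : ℕ) (2 : ℝ))
    refine Eq.mp (congrArg (fun g => HasSum g _) (funext fun k => ?_)) h
    by_cases hk : k = 0 <;> simp [hk, hn2]
  have hr22 : r ^ 2 < 1 := by nlinarith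
  have hB : HasSum (fun k : ℕ => r ^ (2 * (k + 1)) *
      ‖(if k + 1 = 0 then (0 : ℍ[ℝ]) else -2)‖ ^ 2) ((1 - r ^ 2)⁻¹ * (4 * r ^ 2)) := by
    have h := (hasSum_geometric_of_lt_one (sq_nonneg r) hr22).mul_right (4 * r ^ 2)
    refine Eq.mp (congrArg (fun g => HasSum g _) (funext fun k => ?_)) h
    rw [if_neg (Nat.succ_ne_zero k), hn2]; ring
  rw [hA.tsum_eq, hB.tsum_eq]
  have h1 : 0 < 1 - r := by linarith
  have h2 : 0 < 1 - r ^ 2 := by linarith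
  have e : (1 - r)⁻¹ * 2 - 2 + (1 / (1 + 0) + r / (1 - r)) * ((1 - r ^ 2)⁻¹ * (4 * r ^ 2)) - 1
      = -(3 * r ^ 3 - 5 * r ^ 2 - 3 * r + 1) / ((1 - r) * (1 - r ^ 2)) := by
    have := h1.ne'
    have := h2.ne'
    field_simp
    ring
  have : 0 < -(3 * r ^ 3 - 5 * r ^ 2 - 3 * r + 1) / ((1 - r) * (1 - r ^ 2)) :=
    div_pos (by linarith) (mul_pos h1 h2)
  linarith
end
end

section
/- For every m ∈ (0,2], the function F(t) = (1 − t^m)/(2 − t² − t^m) is decreasing on [0,1), and F(t) ≥ m/(2+m) for all t ∈ [0,1); moreover F(t) → m/(2+m) as t → 1⁻. -/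
theorem bohr_core_generalized (m : ℝ) (hm0 : 0 < m) (hm2 : m ≤ 2) :
    AntitoneOn (fun t : ℝ => (1 - t ^ m) / (2 - t ^ 2 - t ^ m)) (Set.Ico 0 1) ∧
    (∀ t ∈ Set.Ico (0 : ℝ) 1, m / (2 + m) ≤ (1 - t ^ m) / (2 - t ^ 2 - t ^ m)) ∧
    Filter.Tendsto (fun t : ℝ => (1 - t ^ m) / (2 - t ^ 2 - t ^ m))
      (nhdsWithin 1 (Set.Iio 1)) (nhds (m / (2 + m))) := by
  have hlt : ∀ t ∈ Set.Ico (0 : ℝ) 1, t ^ m < 1 := fun t ht =>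
    Real.rpow_lt_one ht.1 ht.2 hm0
  have hsq : ∀ t ∈ Set.Ico (0 : ℝ) 1, t ^ 2 < 1 := fun t ht => by
    nlinarith [ht.1, ht.2]
  have hpos : ∀ t ∈ Set.Ico (0 : ℝ) 1, 0 < 2 - t ^ 2 - t ^ m := fun t ht => by
    linarith [hlt t ht, hsq t ht]
  refine ⟨?_, ?_, ?_⟩
  · intro a ha b hb hab
    have hp : 1 ≤ 2 / m := by rw [le_div_iff₀ hm0]; linarith
    have hpow : ∀ t ∈ Set.Ico (0 : ℝ) 1, (t ^ m) ^ (2 / m) = t ^ 2 := fun t ht => by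
      rw [← Real.rpow_mul ht.1, mul_div_cancel₀ _ hm0.ne']
      exact Real.rpow_two t
    have hs : a ^ m ≤ b ^ m := Real.rpow_le_rpow ha.1 hab hm0.le
    have hs0 : 0 ≤ a ^ m := Real.rpow_nonneg ha.1 m
    have h1 := hlt a ha
    have h2 := hlt b hb
    have hd : 0 < 1 - a ^ m := by linarith
    have hmem : a ^ m ∈ Set.Ici (0 : ℝ) := hs0
    have hmem1 : (1 : ℝ) ∈ Set.Ici (0 : ℝ) := zero_le_one' ℝ
    have hx : 0 ≤ (1 - b ^ m) / (1 - a ^ m) := div_nonneg (by linarith) hd.le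
    have hy : 0 ≤ (b ^ m - a ^ m) / (1 - a ^ m) := div_nonneg (by linarith) hd.le
    have hxy : (1 - b ^ m) / (1 - a ^ m) + (b ^ m - a ^ m) / (1 - a ^ m) = 1 := by
      field_simp; ring
    have hc := (convexOn_rpow hp).2 hmem hmem1 hx hy hxy
    simp only [smul_eq_mul, Real.one_rpow] at hc
    have he : (1 - b ^ m) / (1 - a ^ m) * a ^ m + (b ^ m - a ^ m) / (1 - a ^ m) * 1 = b ^ m := by
      field_simp; ring
    rw [he, hpow a ha, hpow b hb, mul_one, div_mul_eq_mul_div, ← add_div, le_div_iff₀ hd] at hc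
    show (1 - b ^ m) / (2 - b ^ 2 - b ^ m) ≤ (1 - a ^ m) / (2 - a ^ 2 - a ^ m)
    rw [div_le_div_iff₀ (hpos b hb) (hpos a ha)]
    nlinarith
  · intro t ht
    have hb := rpow_one_add_le_one_add_mul_self (s := t ^ 2 - 1) (by nlinarith [sq_nonneg t])
      (p := m / 2) (by positivity) (by linarith)
    have he : (1 + (t ^ 2 - 1)) ^ (m / 2) = t ^ m := by
      rw [add_sub_cancel, ← Real.rpow_two, ← Real.rpow_mul ht.1]
      congr 1; ring
    rw [he] at hb
    rw [div_le_div_iff₀ (by linarith) (hpos t ht)]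
    nlinarith
  · have hA : HasDerivAt (fun t : ℝ => t ^ m) m 1 := by
      simpa using Real.hasDerivAt_rpow_const (x := 1) (p := m) (Or.inl one_ne_zero)
    have hB : HasDerivAt (fun t : ℝ => t ^ 2) 2 1 := by
      simpa using hasDerivAt_pow 2 (1 : ℝ)
    have hle : nhdsWithin (1 : ℝ) (Set.Iio 1) ≤ nhdsWithin 1 {1}ᶜ :=
      nhdsWithin_mono _ (fun x hx => ne_of_lt hx)
    have tA := (hasDerivAt_iff_tendsto_slope.1 hA).mono_left hle
    have tB := (hasDerivAt_iff_tendsto_slope.1 hB).mono_left hle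
    refine (tA.div (tB.add tA) (by positivity)).congr' ?_
    filter_upwards [self_mem_nhdsWithin] with t ht
    have h : t - 1 ≠ 0 := sub_ne_zero.2 (ne_of_lt ht)
    simp only [Pi.div_apply, slope_def_field, Real.one_rpow, one_pow]
    rw [← add_div, div_div_div_cancel_right₀ h, ← neg_div_neg_eq]
    congr 1 <;> ring
end

section
/- For every m ∈ (0,1], every real r with 0 ≤ r ≤ m/(m+2), and every t ∈ [0,1], one has t^m + (1 − t²)·r/(1−r) + (1/(1+t) + r/(1−r))·(1 − t²)²·r²/(1 − r²) ≤ 1 (interpreting the expression by continuity when r = 0). -/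
theorem bohr_core_refined (m : ℝ) (hm0 : 0 < m) (hm1 : m ≤ 1)
    (r : ℝ) (hr0 : 0 ≤ r) (hr1 : r ≤ m / (m + 2)) (t : ℝ) (ht0 : 0 ≤ t) (ht1 : t ≤ 1) :
    t ^ m + (1 - t ^ 2) * r / (1 - r) +
      (1 / (1 + t) + r / (1 - r)) * (1 - t ^ 2) ^ 2 * r ^ 2 / (1 - r ^ 2) ≤ 1 := by
  have hB : t ^ m ≤ 1 - m * (1 - t) := by
    have h := rpow_one_add_le_one_add_mul_self (s := t - 1) (by linarith) hm0.le hm1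
    have e : 1 + (t - 1) = t := by ring
    rw [e] at h
    linarith
  have hr2 : r * (m + 2) ≤ m := (le_div_iff₀ (by linarith)).1 hr1
  have hr3 : r < 1 := by nlinarith
  have h1r : 0 < 1 - r := by linarith
  have h1r2 : 0 < 1 - r ^ 2 := by nlinarith
  have h1t : 0 < 1 + t := by linarith
  have hs : r / (1 - r) ≤ m / 2 := by
    rw [div_le_div_iff₀ h1r (by norm_num)]; linarith
  have hs0 : 0 ≤ r / (1 - r) := by positivity
  have hq : (m + 1) * (r ^ 2 / (1 - r ^ 2)) ≤ m ^ 2 / 4 := by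
    have hsq : (r * (m + 2)) ^ 2 ≤ m ^ 2 := pow_le_pow_left₀ (by positivity) hr2 2
    rw [← mul_div_assoc, div_le_div_iff₀ h1r2 (by norm_num)]
    nlinarith
  have hq0 : 0 ≤ r ^ 2 / (1 - r ^ 2) := by positivity
  have e2 : (1 - t ^ 2) * r / (1 - r) = (1 - t ^ 2) * (r / (1 - r)) := by ring
  have e3 : (1 / (1 + t) + r / (1 - r)) * (1 - t ^ 2) ^ 2 * r ^ 2 / (1 - r ^ 2)
      = (1 - t) ^ 2 * (((1 + t) * (1 + r / (1 - r) * (1 + t))) * (r ^ 2 / (1 - r ^ 2))) := by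
    have : (1 / (1 + t) + r / (1 - r)) * (1 - t ^ 2) ^ 2
        = (1 - t) ^ 2 * ((1 + t) * (1 + r / (1 - r) * (1 + t))) := by
      generalize r / (1 - r) = s
      field_simp
      ring
    rw [this]; ring
  rw [e2, e3]
  generalize r / (1 - r) = s at *
  generalize r ^ 2 / (1 - r ^ 2) = q at *
  have hA : (1 - t ^ 2) * s ≤ (1 - t ^ 2) * (m / 2) :=
    mul_le_mul_of_nonneg_left hs (by nlinarith)
  have hC1 : s * (1 + t) ≤ m / 2 * 2 := by gcongr; linarith
  have hC : (1 + t) * (1 + s * (1 + t)) ≤ 2 * (m + 1) := by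
    have : (1 + t) * (1 + s * (1 + t)) ≤ 2 * (1 + s * (1 + t)) := by
      gcongr; linarith
    linarith
  have hD : (1 + t) * (1 + s * (1 + t)) * q ≤ m ^ 2 / 2 := by
    have := mul_le_mul_of_nonneg_right hC hq0
    linarith
  have hE := mul_le_mul_of_nonneg_left hD (sq_nonneg (1 - t))
  have hF : 0 ≤ (1 - t) ^ 2 * (m * (1 - m)) :=
    mul_nonneg (sq_nonneg _) (mul_nonneg hm0.le (by linarith))
  nlinarith
end

section
/- The cubic polynomial 3r³ − 5r² − 3r + 1 has exactly one root R_* in the interval (0,1), and for every α ∈ (0,1] and every real r with 0 ≤ r ≤ R_*, one has Q(α, r) := 4r³α² − (7r³ + 3r² − 3r + 1)α + 6r³ − 2r² − 6r + 2 ≥ 0. -/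
/-- The slope factor of the cubic is negative on the unit square. -/
lemma bohr_slope_neg (x y : ℝ) (hx : 0 ≤ x) (hx1 : x ≤ 1) (hy : 0 ≤ y) (hy1 : y ≤ 1) :
    3 * (x ^ 2 + x * y + y ^ 2) - 5 * (x + y) - 3 < 0 := by
  have h1 : x ^ 2 ≤ x := by nlinarith
  have h2 : y ^ 2 ≤ y := by nlinarith
  have h3 : x * y ≤ x := by nlinarith
  linarith

theorem bohr_core_re_le_one :
    ∃ R : ℝ, (0 < R ∧ R < 1 ∧ 3 * R ^ 3 - 5 * R ^ 2 - 3 * R + 1 = 0) ∧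
      (∀ R' : ℝ, 0 < R' → R' < 1 → 3 * R' ^ 3 - 5 * R' ^ 2 - 3 * R' + 1 = 0 → R' = R) ∧
      (∀ α : ℝ, 0 < α → α ≤ 1 → ∀ r : ℝ, 0 ≤ r → r ≤ R →
        0 ≤ 4 * r ^ 3 * α ^ 2 - (7 * r ^ 3 + 3 * r ^ 2 - 3 * r + 1) * α +
          6 * r ^ 3 - 2 * r ^ 2 - 6 * r + 2) := by
  have hc : ContinuousOn (fun x : ℝ => 3 * x ^ 3 - 5 * x ^ 2 - 3 * x + 1) (Set.Icc 0 1) := by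
    fun_prop
  obtain ⟨R, ⟨h0, h1⟩, hR⟩ := intermediate_value_Ioo' (zero_le_one' ℝ) hc
    (show (0 : ℝ) ∈ Set.Ioo _ _ by constructor <;> norm_num)
  simp only at hR
  refine ⟨R, ⟨h0, h1, hR⟩, ?_, ?_⟩
  · intro x hx0 hx1 hx
    have hs := bohr_slope_neg x R hx0.le hx1.le h0.le h1.le
    have hm : (x - R) * (3 * (x ^ 2 + x * R + R ^ 2) - 5 * (x + R) - 3) = 0 := by
      linear_combination hx - hR
    rcases mul_eq_zero.mp hm with h | h
    · linarith
    · exact absurd h hs.ne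
  · intro a ha0 ha1 r hr0 hrR
    have hs := bohr_slope_neg r R hr0 (by linarith) h0.le h1.le
    have hp := mul_nonneg_of_nonpos_of_nonpos (sub_nonpos.mpr hrR) hs.le
    have ha : 0 ≤ 1 - a := by linarith
    have hr : 0 ≤ 1 - r := by linarith
    have hq : 0 ≤ (1 - a) * ((1 - r) ^ 3 + 4 * r ^ 3 * (1 - a)) := by positivity
    linarith
end
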